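/- Let m ≥ 1 and ν ≥ 1 be integers and let N ⊆ ℝ^ν be a nonempty compact set admitting a C^1 retraction Π as in the context. There exist constants A, B, δ ∈ (0,∞), depending only on m, ν, N, ρ_N and Π, with the following property. Let u : ℝ^m → ℝ^ν be Borel measurable with u(x) ∈ N for Lebesgue-almost every x ∈ ℝ^m and with finite Gagliardo energy E := ∬_{ℝ^m×ℝ^m} |u(x)−u(y)|^{m+1}/|x−y|^{2m} dx dy < ∞, and set G := ∬_{{(x,y)∈ℝ^m×ℝ^m : |u(x)−u(y)| ≥ δ}} |x−y|^{−2m} dx dy. Then there exist a finite set S ⊆ ℝ^{m+1}_+ with card S ≤ A·e^{B·G}·E and a map U : ℝ^{m+1}_+ → ℝ^ν such that: (i) U(x) ∈ N for every x ∈ ℝ^{m+1}_+; (ii) U is continuous on ℝ^{m+1}_+ \ S; (iii) U is differentiable at Lebesgue-almost every point of ℝ^{m+1}_+; (iv) for every t ∈ (0,∞), t^{m+1}·L^{m+1}({x ∈ ℝ^{m+1}_+ : U is differentiable at x and ‖DU(x)‖ ≥ t}) ≤ A·e^{B·G}·E; (v) u is the trace of U in the sense that for every compact set K ⊆ ℝ^m,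 lim_{ε→0⁺} (1/ε)·∫_{K×(0,ε)} |U(y,s) − u(y)| dy ds = 0. -/

import Mathlib

open MeasureTheory Metric Set Filter
open scoped ENNReal Topology

noncomputable section

abbrev Euc (m : ℕ) : Type := EuclideanSpace ℝ (Fin m)

/-- The gap potential `∬_{{|u(x) - u(y)| ≥ δ}} |x - y|^{-2m} dx dy` of a map
`u : ℝ^m → ℝ^ν`. -/
def gapPotential (m ν : ℕ) (δ : ℝ) (u : Euc m → Euc ν) : ℝ≥0∞ :=
  ∫⁻ x, ∫⁻ y,
    if δ ≤ dist (u x) (u y) then (ENNReal.ofReal (dist x y ^ (2 * m)))⁻¹ else 0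

/-- The Gagliardo energy `∬ |u(x) - u(y)|^{m+1} / |x - y|^{2m} dx dy` of a map
`u : ℝ^m → ℝ^ν`. -/
def gagliardoEnergy (m ν : ℕ) (u : Euc m → Euc ν) : ℝ≥0∞ :=
  ∫⁻ x, ∫⁻ y, ENNReal.ofReal (dist (u x) (u y) ^ (m + 1)) /
    ENNReal.ofReal (dist x y ^ (2 * m))

/-- The right-hand side `A · e^{B·G} · E` of the weak-type estimates. -/
def gapBound (m ν : ℕ) (A B δ : ℝ) (u : Euc m → Euc ν) : ℝ≥0∞ :=
  ENNReal.ofReal (A * Real.exp (B * (gapPotential m ν δ u).toReal)) *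
    gagliardoEnergy m ν u

/-- The volume of the unit ball of `ℝ^m`. -/
def unitVol (m : ℕ) : ℝ := volume.real (ball (0 : Euc m) 1)

lemma unitVol_pos (m : ℕ) : 0 < unitVol m := by
  unfold unitVol
  rw [Measure.real]
  exact ENNReal.toReal_pos (measure_ball_pos _ _ one_pos).ne' measure_ball_lt_top.ne

lemma volume_ball_euc {m : ℕ} (x : Euc m) {r : ℝ} (hr : 0 < r) :
    volume (ball x r) = ENNReal.ofReal (r ^ m * unitVol m) := by
  rw [Measure.addHaar_ball_of_pos volume x hr, ENNReal.ofReal_mul (by positivity), unitVol,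
    Measure.real, ENNReal.ofReal_toReal measure_ball_lt_top.ne]
  simp

/-- The conical averaging weight of height `X.2` centred at `X.1`. -/
def coneWeight {m : ℕ} (X : Euc m × ℝ) (z : Euc m) : ℝ := max 0 (X.2 - dist z X.1)

lemma coneWeight_nonneg {m : ℕ} (X : Euc m × ℝ) (z : Euc m) : 0 ≤ coneWeight X z :=
  le_max_left _ _

lemma continuous_coneWeight {m : ℕ} (X : Euc m × ℝ) : Continuous (coneWeight X) := by
  unfold coneWeight; fun_prop

lemma coneWeight_eq_zero {m : ℕ} {X : Euc m × ℝ} {z : Euc m} (h : z ∉ ball X.1 X.2) :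
    coneWeight X z = 0 := by
  rw [mem_ball, not_lt] at h
  exact max_eq_left (by linarith)

lemma coneWeight_le {m : ℕ} {X : Euc m × ℝ} (hX : 0 < X.2) (z : Euc m) :
    coneWeight X z ≤ X.2 :=
  max_le hX.le (by linarith [dist_nonneg (x := z) (y := X.1)])

lemma abs_coneWeight_sub_le {m : ℕ} (X Y : Euc m × ℝ) (z : Euc m) :
    |coneWeight X z - coneWeight Y z| ≤ 2 * dist X Y := by
  have h1 := abs_max_sub_max_le_abs (X.2 - dist z X.1) (Y.2 - dist z Y.1) 0
  have h2 : dist X.1 Y.1 ≤ dist X Y := by rw [Prod.dist_eq]; exact le_max_left _ _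
  have h3 : dist X.2 Y.2 ≤ dist X Y := by rw [Prod.dist_eq]; exact le_max_right _ _
  have h4 : |dist z X.1 - dist z Y.1| ≤ dist X.1 Y.1 := by
    rw [dist_comm z, dist_comm z]; exact abs_dist_sub_le _ _ _
  rw [Real.dist_eq] at h3
  unfold coneWeight
  rw [max_comm 0, max_comm 0]
  refine h1.trans ?_
  rw [abs_le] at *
  constructor <;> linarith

lemma integrable_coneWeight {m : ℕ} (X : Euc m × ℝ) : Integrable (coneWeight X) := by
  refine (continuous_coneWeight X).integrable_of_hasCompactSupport ?_
  refine HasCompactSupport.intro (isCompact_closedBall X.1 X.2) fun z hz => ?_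
  exact coneWeight_eq_zero fun h => hz (ball_subset_closedBall h)

/-- The total mass of the averaging weight. -/
def coneMass {m : ℕ} (X : Euc m × ℝ) : ℝ := ∫ z, coneWeight X z

lemma le_coneMass {m : ℕ} {X : Euc m × ℝ} (hX : 0 < X.2) :
    X.2 ^ (m + 1) * unitVol m / 2 ^ (m + 1) ≤ coneMass X := by
  have h1 : ∫ z in ball X.1 (X.2 / 2), X.2 / 2 ≤ ∫ z in ball X.1 (X.2 / 2), coneWeight X z := by
    refine setIntegral_mono_on ?_ (integrable_coneWeight X).integrableOn measurableSet_ball ?_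
    · exact integrableOn_const measure_ball_lt_top.ne
    · intro z hz
      rw [mem_ball] at hz
      exact le_max_of_le_right (by linarith)
  have h2 := setIntegral_le_integral (s := ball X.1 (X.2 / 2)) (integrable_coneWeight X)
    (Eventually.of_forall (coneWeight_nonneg X))
  refine le_trans (le_of_eq ?_) (h1.trans h2)
  have := unitVol_pos m
  rw [setIntegral_const, Measure.real, volume_ball_euc _ (by positivity),
    ENNReal.toReal_ofReal (by positivity), smul_eq_mul]
  rw [div_pow, pow_succ, pow_succ]
  field_simp

lemma coneMass_pos {m : ℕ} {X : Euc m × ℝ} (hX : 0 < X.2) : 0 < coneMass X := by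
  have := unitVol_pos m
  exact lt_of_lt_of_le (by positivity) (le_coneMass hX)

/-- The extension of `u` to the half-space by averaging. -/
def coneAverage {m ν : ℕ} (u : Euc m → Euc ν) (X : Euc m × ℝ) : Euc ν :=
  (coneMass X)⁻¹ • ∫ z, coneWeight X z • u z

/-- The dimensional constant controlling averages by means over balls. -/
def avgConst (m : ℕ) : ℝ := 2 ^ (m + 1) / unitVol m

lemma avgConst_pos (m : ℕ) : 0 < avgConst m := div_pos (by positivity) (unitVol_pos m)

lemma inv_coneMass_le {m : ℕ} {X : Euc m × ℝ} (hX : 0 < X.2) :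
    (coneMass X)⁻¹ ≤ avgConst m / X.2 ^ (m + 1) := by
  have := unitVol_pos m
  refine (inv_anti₀ (by positivity) (le_coneMass hX)).trans (le_of_eq ?_)
  unfold avgConst
  field_simp

lemma integrable_coneWeight_smul {m ν : ℕ} {u : Euc m → Euc ν} (hu : Measurable u) {D : ℝ}
    (hD : ∀ z, ‖u z‖ ≤ D) (X : Euc m × ℝ) : Integrable fun z => coneWeight X z • u z :=
  (integrable_coneWeight X).smul_bdd D hu.aestronglyMeasurable (Eventually.of_forall hD)

lemma coneAverage_sub {m ν : ℕ} {u : Euc m → Euc ν} (hu : Measurable u) {D : ℝ}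
    (hD : ∀ z, ‖u z‖ ≤ D) {X : Euc m × ℝ} (hX : 0 < X.2) (a : Euc ν) :
    coneAverage u X - a = (coneMass X)⁻¹ • ∫ z, coneWeight X z • (u z - a) := by
  simp_rw [smul_sub]
  rw [integral_sub (integrable_coneWeight_smul hu hD X) ((integrable_coneWeight X).smul_const a),
    integral_smul_const, smul_sub, coneAverage, ← coneMass, smul_smul,
    inv_mul_cancel₀ (coneMass_pos hX).ne', one_smul]

lemma integral_coneWeight_smul_sub {m ν : ℕ} {u : Euc m → Euc ν} (hu : Measurable u) {D : ℝ}
    (hD : ∀ z, ‖u z‖ ≤ D) {X : Euc m × ℝ} (hX : 0 < X.2) :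
    ∫ z, coneWeight X z • (u z - coneAverage u X) = 0 := by
  have h := coneAverage_sub hu hD hX (coneAverage u X)
  rw [sub_self, eq_comm, smul_eq_zero] at h
  exact h.resolve_left (inv_pos.2 (coneMass_pos hX)).ne'

lemma enorm_coneAverage_sub_le {m ν : ℕ} {u : Euc m → Euc ν} (hu : Measurable u) {D : ℝ}
    (hD : ∀ z, ‖u z‖ ≤ D) {X : Euc m × ℝ} (hX : 0 < X.2) (a : Euc ν) :
    ‖coneAverage u X - a‖ₑ ≤
      ENNReal.ofReal (avgConst m / X.2 ^ m) * ∫⁻ z in ball X.1 X.2, ‖u z - a‖ₑ := by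
  have hM := coneMass_pos hX
  rw [coneAverage_sub hu hD hX, enorm_smul, Real.enorm_eq_ofReal (inv_pos.2 hM).le]
  have h1 : ‖∫ z, coneWeight X z • (u z - a)‖ₑ ≤
      ENNReal.ofReal X.2 * ∫⁻ z in ball X.1 X.2, ‖u z - a‖ₑ := by
    refine (enorm_integral_le_lintegral_enorm _).trans ?_
    rw [← lintegral_const_mul _ (by fun_prop), ← lintegral_indicator measurableSet_ball]
    refine lintegral_mono fun z => ?_
    by_cases hz : z ∈ ball X.1 X.2
    · rw [indicator_of_mem hz, enorm_smul, Real.enorm_eq_ofReal (coneWeight_nonneg X z)]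
      gcongr
      exact coneWeight_le hX z
    · simp [coneWeight_eq_zero hz]
  refine (mul_le_mul_right h1 _).trans ?_
  rw [← mul_assoc, ← ENNReal.ofReal_mul (inv_pos.2 hM).le]
  gcongr
  refine (mul_le_mul_of_nonneg_right (inv_coneMass_le hX) hX.le).trans (le_of_eq ?_)
  rw [pow_succ]; field_simp

/-- The first-order oscillation of `u` on a ball. -/
def osc {m ν : ℕ} (u : Euc m → Euc ν) (x : Euc m) (r : ℝ) : ℝ≥0∞ :=
  ∫⁻ z in ball x r, ∫⁻ y in ball x r, ‖u y - u z‖ₑ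

lemma enorm_coneAverage_sub_coneAverage_le {m ν : ℕ} {u : Euc m → Euc ν} (hu : Measurable u)
    {D : ℝ} (hD : ∀ z, ‖u z‖ ≤ D) {X Y : Euc m × ℝ} (hX : 0 < X.2)
    (hXY : dist X Y ≤ X.2 / 2) :
    ‖coneAverage u X - coneAverage u Y‖ₑ ≤
      ENNReal.ofReal (2 ^ (m + 1) * avgConst m ^ 2 / X.2 ^ (2 * m + 1) * dist X Y) *
        osc u X.1 (2 * X.2) := by
  have h1 : dist X.1 Y.1 ≤ dist X Y := by rw [Prod.dist_eq]; exact le_max_left _ _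
  have h2 : dist X.2 Y.2 ≤ dist X Y := by rw [Prod.dist_eq]; exact le_max_right _ _
  rw [Real.dist_eq, abs_le] at h2
  have hY : X.2 / 2 ≤ Y.2 := by linarith
  have hY0 : 0 < Y.2 := by linarith
  have hM := coneMass_pos hX
  have hC := avgConst_pos m
  have hsub : ball Y.1 Y.2 ⊆ ball X.1 (2 * X.2) :=
    ball_subset_ball' (by rw [dist_comm]; linarith)
  have hsubX : ball X.1 X.2 ⊆ ball X.1 (2 * X.2) := ball_subset_ball (by linarith)
  have h_integrable : ∀ Z, Integrable fun z => coneWeight Z z • (u z - coneAverage u Y) := fun Z =>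
    integrable_coneWeight_smul (D := D + ‖coneAverage u Y‖) (hu.sub_const _)
      (fun z => (norm_sub_le _ _).trans (by gcongr; exact hD z)) Z
  have hrep : coneAverage u X - coneAverage u Y = (coneMass X)⁻¹ •
      ∫ z, (coneWeight X z - coneWeight Y z) • (u z - coneAverage u Y) := by
    simp_rw [sub_smul]
    rw [integral_sub (h_integrable X) (h_integrable Y), integral_coneWeight_smul_sub hu hD hY0, sub_zero,
      coneAverage_sub hu hD hX]
  have hbd : ∀ z, ‖coneAverage u Y - u z‖ₑ ≤ ENNReal.ofReal (2 ^ m * avgConst m / X.2 ^ m) *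
      ∫⁻ y in ball X.1 (2 * X.2), ‖u y - u z‖ₑ := by
    intro z
    refine (enorm_coneAverage_sub_le hu hD hY0 (u z)).trans ?_
    refine mul_le_mul' (ENNReal.ofReal_le_ofReal ?_) (lintegral_mono_set hsub)
    calc avgConst m / Y.2 ^ m ≤ avgConst m / (X.2 / 2) ^ m := by gcongr
      _ = _ := by rw [div_pow]; field_simp
  have h_int_le : ‖∫ z, (coneWeight X z - coneWeight Y z) • (u z - coneAverage u Y)‖ₑ ≤
      ENNReal.ofReal (2 * dist X Y) * (ENNReal.ofReal (2 ^ m * avgConst m / X.2 ^ m) *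
        osc u X.1 (2 * X.2)) := by
    refine (enorm_integral_le_lintegral_enorm _).trans ?_
    unfold osc
    rw [← lintegral_const_mul' _ _ ENNReal.ofReal_ne_top,
      ← lintegral_const_mul' _ _ ENNReal.ofReal_ne_top, ← lintegral_indicator measurableSet_ball]
    refine lintegral_mono fun z => ?_
    by_cases hz : z ∈ ball X.1 (2 * X.2)
    · rw [indicator_of_mem hz, enorm_smul]
      refine mul_le_mul' ?_ ?_
      · rw [Real.enorm_eq_ofReal_abs]
        exact ENNReal.ofReal_le_ofReal (abs_coneWeight_sub_le X Y z)
      · rw [← enorm_neg, neg_sub]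
        exact hbd z
    · rw [coneWeight_eq_zero fun h => hz (hsubX h), coneWeight_eq_zero fun h => hz (hsub h)]
      simp
  rw [hrep, enorm_smul, Real.enorm_eq_ofReal (inv_pos.2 hM).le]
  refine (mul_le_mul_right h_int_le _).trans ?_
  rw [← mul_assoc, ← mul_assoc, ← ENNReal.ofReal_mul (inv_pos.2 hM).le,
    ← ENNReal.ofReal_mul (by positivity)]
  refine mul_le_mul' (ENNReal.ofReal_le_ofReal ?_) le_rfl
  calc (coneMass X)⁻¹ * (2 * dist X Y) * (2 ^ m * avgConst m / X.2 ^ m)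
      ≤ avgConst m / X.2 ^ (m + 1) * (2 * dist X Y) * (2 ^ m * avgConst m / X.2 ^ m) := by
        gcongr; exact inv_coneMass_le hX
    _ = _ := by field_simp; ring

lemma osc_le {m ν : ℕ} {u : Euc m → Euc ν} {D : ℝ} (hD : ∀ y z, ‖u y - u z‖ ≤ D)
    (x : Euc m) {r : ℝ} (hr : 0 < r) :
    osc u x r ≤ ENNReal.ofReal (D * (r ^ m * unitVol m) ^ 2) := by
  have hω := unitVol_pos m
  have hD0 : 0 ≤ D := (norm_nonneg _).trans (hD 0 0)
  calc osc u x r ≤ ∫⁻ _ in ball x r, ∫⁻ _ in ball x r, ENNReal.ofReal D := by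
        unfold osc
        gcongr with z y
        rw [← ofReal_norm]
        exact ENNReal.ofReal_le_ofReal (hD y z)
    _ = _ := by
        simp only [lintegral_const, Measure.restrict_apply MeasurableSet.univ, univ_inter,
          volume_ball_euc x hr]
        rw [← ENNReal.ofReal_mul hD0, ← ENNReal.ofReal_mul (by positivity)]
        congr 1; ring

/-- The constant in the Lipschitz estimate for averages. -/
def lipConst (m : ℕ) (D : ℝ) : ℝ :=
  2 ^ (m + 1) * avgConst m ^ 2 * (D * (2 ^ m * unitVol m) ^ 2)

lemma lipConst_nonneg (m : ℕ) {D : ℝ} (hD : 0 ≤ D) : 0 ≤ lipConst m D := by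
  have := unitVol_pos m
  unfold lipConst; positivity

lemma norm_coneAverage_sub_coneAverage_le {m ν : ℕ} {u : Euc m → Euc ν} (hu : Measurable u)
    {D₀ D : ℝ} (hD₀ : ∀ z, ‖u z‖ ≤ D₀) (hD : ∀ y z, ‖u y - u z‖ ≤ D) {X Y : Euc m × ℝ}
    (hX : 0 < X.2) (hXY : dist X Y ≤ X.2 / 2) :
    ‖coneAverage u X - coneAverage u Y‖ ≤ lipConst m D / X.2 * dist X Y := by
  have hD' : 0 ≤ D := (norm_nonneg _).trans (hD 0 0)
  have hω := unitVol_pos m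
  have h := (enorm_coneAverage_sub_coneAverage_le hu hD₀ hX hXY).trans
    (mul_le_mul' le_rfl (osc_le hD X.1 (r := 2 * X.2) (by positivity)))
  rw [← ENNReal.ofReal_mul (by positivity), ← ofReal_norm,
    ENNReal.ofReal_le_ofReal_iff (by positivity)] at h
  refine h.trans (le_of_eq ?_)
  unfold lipConst
  rw [mul_pow, mul_pow]
  field_simp
  ring

lemma ofReal_infDist_mul_le {m ν : ℕ} {u : Euc m → Euc ν} (hu : Measurable u)
    {D₀ : ℝ} (hD₀ : ∀ z, ‖u z‖ ≤ D₀) {N : Set (Euc ν)} (hN : ∀ z, u z ∈ N) {X : Euc m × ℝ}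
    (hX : 0 < X.2) :
    ENNReal.ofReal (infDist (coneAverage u X) N * (X.2 ^ m * unitVol m)) ≤
      ENNReal.ofReal (avgConst m / X.2 ^ m) * osc u X.1 X.2 := by
  rw [ENNReal.ofReal_mul infDist_nonneg, ← volume_ball_euc X.1 hX, ← setLIntegral_const]
  unfold osc
  rw [← lintegral_const_mul' _ _ ENNReal.ofReal_ne_top]
  refine lintegral_mono fun z => ?_
  refine le_trans ?_ (enorm_coneAverage_sub_le hu hD₀ hX (u z))
  rw [← ofReal_norm, ← dist_eq_norm]
  exact ENNReal.ofReal_le_ofReal (infDist_le_dist_of_mem (hN z))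

lemma osc_eq_setLIntegral {m ν : ℕ} {u : Euc m → Euc ν} (hu : Measurable u) (x : Euc m) (r : ℝ) :
    osc u x r = ∫⁻ p in ball x r ×ˢ ball x r, ‖u p.2 - u p.1‖ₑ := by
  rw [Measure.volume_eq_prod, ← Measure.prod_restrict, lintegral_prod _ (by fun_prop)]
  rfl

/-- The well-separated pairs of points of the ball underlying `X`. -/
def farPairs {m : ℕ} (ε : ℝ) (X : Euc m × ℝ) : Set (Euc m × Euc m) :=
  (ball X.1 X.2 ×ˢ ball X.1 X.2) ∩ {p | ε * X.2 ≤ dist p.1 p.2}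

lemma measurableSet_farPairs {m : ℕ} (ε : ℝ) (X : Euc m × ℝ) :
    MeasurableSet (farPairs ε X) :=
  (measurableSet_ball.prod measurableSet_ball).inter
    (measurableSet_le (by fun_prop) (by fun_prop))

/-- The integrand of the gap potential. -/
def gapKernel {m ν : ℕ} (δ : ℝ) (u : Euc m → Euc ν) (p : Euc m × Euc m) : ℝ≥0∞ :=
  if δ ≤ dist (u p.1) (u p.2) then (ENNReal.ofReal (dist p.1 p.2 ^ (2 * m)))⁻¹ else 0

lemma measurable_gapKernel {m ν : ℕ} (δ : ℝ) {u : Euc m → Euc ν} (hu : Measurable u) :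
    Measurable (gapKernel δ u) := by
  refine Measurable.ite (measurableSet_le (by fun_prop) (by fun_prop)) ?_ measurable_const
  fun_prop

lemma gapPotential_eq {m ν : ℕ} (δ : ℝ) {u : Euc m → Euc ν} (hu : Measurable u) :
    gapPotential m ν δ u = ∫⁻ p, gapKernel δ u p := by
  rw [Measure.volume_eq_prod, lintegral_prod _ (measurable_gapKernel δ hu).aemeasurable]
  rfl

lemma enorm_sub_le_gapKernel {m ν : ℕ} {u : Euc m → Euc ν} {D δ ε : ℝ} (hε : 0 < ε)
    (hD : ∀ y z, ‖u y - u z‖ ≤ D) {X : Euc m × ℝ} (hX : 0 < X.2) {p : Euc m × Euc m}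
    (hp : p ∈ ball X.1 X.2 ×ˢ ball X.1 X.2) :
    ‖u p.2 - u p.1‖ₑ ≤ ENNReal.ofReal δ +
      (ball p.1 (ε * X.2)).indicator (fun _ => ENNReal.ofReal D) p.2 +
      ENNReal.ofReal (D * (2 * X.2) ^ (2 * m)) * (farPairs ε X).indicator (gapKernel δ u) p := by
  have hD' : 0 ≤ D := (norm_nonneg _).trans (hD 0 0)
  have hD2 : ‖u p.2 - u p.1‖ₑ ≤ ENNReal.ofReal D := by
    rw [← ofReal_norm]; exact ENNReal.ofReal_le_ofReal (hD _ _)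
  by_cases h1 : p.2 ∈ ball p.1 (ε * X.2)
  · rw [indicator_of_mem h1]
    exact hD2.trans (le_add_right le_add_self)
  have h1' : ε * X.2 ≤ dist p.1 p.2 := by rwa [mem_ball, not_lt, dist_comm] at h1
  by_cases h2 : δ ≤ dist (u p.1) (u p.2)
  · refine le_trans ?_ le_add_self
    rw [indicator_of_mem (show p ∈ farPairs ε X from ⟨hp, h1'⟩), gapKernel, if_pos h2]
    have h3 : 0 < dist p.1 p.2 := lt_of_lt_of_le (by positivity) h1'
    have h4 : dist p.1 p.2 ≤ 2 * X.2 := by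
      have := mem_ball.1 hp.1
      have := mem_ball.1 hp.2
      linarith [dist_triangle_right p.1 p.2 X.1]
    rw [← ENNReal.ofReal_inv_of_pos (by positivity), ← ENNReal.ofReal_mul (by positivity)]
    refine hD2.trans (ENNReal.ofReal_le_ofReal ?_)
    rw [mul_assoc]
    refine le_mul_of_one_le_right hD' ?_
    rw [← div_eq_mul_inv, one_le_div (by positivity)]
    gcongr
  · refine le_add_right (le_add_right ?_)
    rw [← ofReal_norm, ← dist_eq_norm, dist_comm]
    exact ENNReal.ofReal_le_ofReal (not_le.1 h2).le

lemma osc_le_gapKernel {m ν : ℕ} {u : Euc m → Euc ν} (hu : Measurable u) {D δ ε : ℝ}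
    (hε : 0 < ε) (hδ : 0 < δ)
    (hD : ∀ y z, ‖u y - u z‖ ≤ D) {X : Euc m × ℝ} (hX : 0 < X.2) :
    osc u X.1 X.2 ≤ ENNReal.ofReal ((δ + D * ε ^ m) * (X.2 ^ m * unitVol m) ^ 2) +
      ENNReal.ofReal (D * (2 * X.2) ^ (2 * m)) * ∫⁻ p in farPairs ε X, gapKernel δ u p := by
  have hω := unitVol_pos m
  have hD' : 0 ≤ D := (norm_nonneg _).trans (hD 0 0)
  set B := ball X.1 X.2 with hB
  have hBm : MeasurableSet (B ×ˢ B) := measurableSet_ball.prod measurableSet_ball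
  have hnear : MeasurableSet {p : Euc m × Euc m | p.2 ∈ ball p.1 (ε * X.2)} :=
    measurableSet_lt (f := fun p : Euc m × Euc m => dist p.2 p.1) (by fun_prop)
      measurable_const
  have hnf : Measurable fun p : Euc m × Euc m =>
      (ball p.1 (ε * X.2)).indicator (fun _ => ENNReal.ofReal D) p.2 :=
    (measurable_const (a := ENNReal.ofReal D)).indicator hnear
  have hgm := (measurable_gapKernel δ hu).indicator (measurableSet_farPairs ε X)
  have hvB : volume B = ENNReal.ofReal (X.2 ^ m * unitVol m) := volume_ball_euc _ hX
  calc osc u X.1 X.2 ≤ ∫⁻ p in B ×ˢ B, (ENNReal.ofReal δ +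
      (ball p.1 (ε * X.2)).indicator (fun _ => ENNReal.ofReal D) p.2 +
      ENNReal.ofReal (D * (2 * X.2) ^ (2 * m)) * (farPairs ε X).indicator (gapKernel δ u) p) := by
        rw [osc_eq_setLIntegral hu]
        exact setLIntegral_mono' hBm fun p hp => enorm_sub_le_gapKernel hε hD hX hp
    _ = (∫⁻ p in B ×ˢ B, ENNReal.ofReal δ) +
        (∫⁻ p in B ×ˢ B, (ball p.1 (ε * X.2)).indicator (fun _ => ENNReal.ofReal D) p.2) +
        ENNReal.ofReal (D * (2 * X.2) ^ (2 * m)) *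
          ∫⁻ p in B ×ˢ B, (farPairs ε X).indicator (gapKernel δ u) p := by
        rw [lintegral_add_left (by fun_prop), lintegral_add_left measurable_const,
          lintegral_const_mul _ hgm]
    _ ≤ ENNReal.ofReal (δ * (X.2 ^ m * unitVol m) ^ 2) +
        ENNReal.ofReal (D * ε ^ m * (X.2 ^ m * unitVol m) ^ 2) +
        ENNReal.ofReal (D * (2 * X.2) ^ (2 * m)) * ∫⁻ p in farPairs ε X, gapKernel δ u p := by
        refine add_le_add (add_le_add ?_ ?_) (mul_le_mul' le_rfl ?_)
        · rw [setLIntegral_const, Measure.volume_eq_prod, Measure.prod_prod, hvB,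
            ← ENNReal.ofReal_mul (by positivity), ← ENNReal.ofReal_mul hδ.le]
          exact le_of_eq (by ring_nf)
        · rw [Measure.volume_eq_prod, ← Measure.prod_restrict, lintegral_prod _ hnf.aemeasurable]
          calc _ ≤ ∫⁻ x in B, ENNReal.ofReal D * ENNReal.ofReal ((ε * X.2) ^ m * unitVol m) := by
                gcongr with x
                refine (setLIntegral_le_lintegral _ _).trans ?_
                rw [lintegral_indicator_const measurableSet_ball, volume_ball_euc _ (by positivity)]
            _ = _ := by
                rw [setLIntegral_const, hvB, ← ENNReal.ofReal_mul hD',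
                  ← ENNReal.ofReal_mul (by positivity)]
                congr 1; ring
        · refine (setLIntegral_le_lintegral _ _).trans ?_
          rw [lintegral_indicator (measurableSet_farPairs ε X)]
    _ = _ := by
        rw [← ENNReal.ofReal_add (by positivity) (by positivity), add_mul]

/-- The parameter `ε = δ` for which bad points carry a definite amount of gap potential. -/
def gapThreshold (m : ℕ) (D ρ : ℝ) : ℝ :=
  min 1 (ρ / (2 * (1 + D) * (avgConst m * unitVol m)))

lemma le_setLIntegral_gapKernel {m ν : ℕ} (hm : 1 ≤ m) {u : Euc m → Euc ν} (hu : Measurable u)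
    {D₀ D ρ : ℝ} (hρ : 0 < ρ) (hD1 : 0 < D)
    (hD₀ : ∀ z, ‖u z‖ ≤ D₀) (hD : ∀ y z, ‖u y - u z‖ ≤ D) {N : Set (Euc ν)}
    (hN : ∀ z, u z ∈ N) {X : Euc m × ℝ} (hX : 0 < X.2)
    (hbad : ρ ≤ infDist (coneAverage u X) N) :
    ENNReal.ofReal (ρ * unitVol m / (2 * D * avgConst m * 2 ^ (2 * m))) ≤
      ∫⁻ p in farPairs (gapThreshold m D ρ) X, gapKernel (gapThreshold m D ρ) u p := by
  have hω := unitVol_pos m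
  have hC := avgConst_pos m
  set δ := gapThreshold m D ρ with hδdef
  have hδ0 : 0 < δ := lt_min one_pos (by positivity)
  have hδ1 : δ ≤ 1 := min_le_left _ _
  have hδ2 : δ ≤ ρ / (2 * (1 + D) * (avgConst m * unitVol m)) := min_le_right _ _
  set I := ∫⁻ p in farPairs δ X, gapKernel δ u p
  by_cases hI : I = ⊤
  · rw [hI]; exact le_top
  obtain ⟨J, hJ0, hJ⟩ : ∃ J : ℝ, 0 ≤ J ∧ I = ENNReal.ofReal J :=
    ⟨I.toReal, ENNReal.toReal_nonneg, (ENNReal.ofReal_toReal hI).symm⟩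
  have h1 := (ofReal_infDist_mul_le hu hD₀ hN hX).trans
    (mul_le_mul' le_rfl (osc_le_gapKernel hu hδ0 hδ0 hD hX))
  change _ ≤ _ * (_ + _ * I) at h1
  rw [hJ, ← ENNReal.ofReal_mul (by positivity), ← ENNReal.ofReal_add (by positivity)
    (by positivity), ← ENNReal.ofReal_mul (by positivity),
    ENNReal.ofReal_le_ofReal_iff (by positivity)] at h1
  rw [hJ]
  refine ENNReal.ofReal_le_ofReal ?_
  have h2 : ρ * (X.2 ^ m * unitVol m) ≤ _ := (by gcongr : _ ≤ _).trans h1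
  have h3 : avgConst m / X.2 ^ m *
      ((δ + D * δ ^ m) * (X.2 ^ m * unitVol m) ^ 2 + D * (2 * X.2) ^ (2 * m) * J) =
      X.2 ^ m * (avgConst m * (δ + D * δ ^ m) * unitVol m ^ 2 +
        avgConst m * D * 2 ^ (2 * m) * J) := by
    rw [mul_pow, mul_pow]; field_simp; ring
  rw [h3, mul_left_comm, mul_le_mul_iff_right₀ (by positivity)] at h2
  have h4 : avgConst m * (δ + D * δ ^ m) * unitVol m ^ 2 ≤ ρ * unitVol m / 2 := by
    have h5 : δ ^ m ≤ δ := pow_le_of_le_one hδ0.le hδ1 (by omega)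
    calc avgConst m * (δ + D * δ ^ m) * unitVol m ^ 2
        ≤ avgConst m * (δ + D * δ) * unitVol m ^ 2 := by gcongr
      _ = avgConst m * (1 + D) * unitVol m ^ 2 * δ := by ring
      _ ≤ avgConst m * (1 + D) * unitVol m ^ 2 *
          (ρ / (2 * (1 + D) * (avgConst m * unitVol m))) := by gcongr
      _ = _ := by field_simp
  rw [div_le_iff₀ (by positivity)]
  nlinarith

lemma card_mul_le_gapPotential {m ν : ℕ} {u : Euc m → Euc ν} (hu : Measurable u) {δ : ℝ}
    {c : ℝ≥0∞} {F : Finset (Euc m × ℝ)}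
    (hF : ∀ X ∈ F, c ≤ ∫⁻ p in farPairs δ X, gapKernel δ u p)
    (hdisj : (F : Set (Euc m × ℝ)).PairwiseDisjoint (farPairs δ)) :
    (F.card : ℝ≥0∞) * c ≤ gapPotential m ν δ u := by
  rw [gapPotential_eq δ hu]
  calc (F.card : ℝ≥0∞) * c = ∑ X ∈ F, c := by simp
    _ ≤ ∑ X ∈ F, ∫⁻ p in farPairs δ X, gapKernel δ u p := Finset.sum_le_sum hF
    _ = ∫⁻ p in ⋃ X ∈ F, farPairs δ X, gapKernel δ u p :=
        (lintegral_biUnion_finset hdisj (fun X _ => measurableSet_farPairs δ X) _).symm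
    _ ≤ _ := setLIntegral_le_lintegral _ _

/-- A maximal disjoint subfamily of the far pair sets of bad points. -/
lemma exists_maximal_finset {m ν : ℕ} {u : Euc m → Euc ν} (hu : Measurable u) {δ : ℝ}
    {c : ℝ≥0∞} (hc : c ≠ 0) (hG : gapPotential m ν δ u ≠ ⊤) {bad : Set (Euc m × ℝ)}
    (hbad : ∀ X ∈ bad, c ≤ ∫⁻ p in farPairs δ X, gapKernel δ u p) :
    ∃ F : Finset (Euc m × ℝ), ↑F ⊆ bad ∧ (F.card : ℝ≥0∞) * c ≤ gapPotential m ν δ u ∧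
      ∀ X ∈ bad, ∃ Y ∈ F, ¬ Disjoint (farPairs δ X) (farPairs δ Y) := by
  classical
  let P : ℕ → Prop := fun n => ∃ F : Finset (Euc m × ℝ), ↑F ⊆ bad ∧
    (F : Set (Euc m × ℝ)).PairwiseDisjoint (farPairs δ) ∧ F.card = n
  have hP0 : P 0 := ⟨∅, by simp, by simp, rfl⟩
  obtain ⟨n₀, hn₀⟩ := ENNReal.exists_nat_gt (ENNReal.div_ne_top hG hc)
  have hPb : ∀ n, P n → n ≤ n₀ := by
    rintro n ⟨F, hF, hd, rfl⟩
    have h := card_mul_le_gapPotential hu (fun X hX => hbad X (hF hX)) hd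
    have h2 : (F.card : ℝ≥0∞) ≤ gapPotential m ν δ u / c := by
      rw [ENNReal.le_div_iff_mul_le (Or.inl hc) (Or.inr hG)]
      exact h
    exact_mod_cast (h2.trans hn₀.le)
  have hmax := Nat.findGreatest_spec (P := P) (Nat.zero_le n₀) hP0
  obtain ⟨F, hF, hd, hcard⟩ := hmax
  refine ⟨F, hF, card_mul_le_gapPotential hu (fun X hX => hbad X (hF hX)) hd, fun X hX => ?_⟩
  have hne : ¬ Disjoint (farPairs δ X) (farPairs δ X) := by
    rw [disjoint_self]
    intro h0
    have := hbad X hX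
    rw [bot_eq_empty] at h0
    simp [h0, hc] at this
  by_contra! hcon
  have hXF : X ∉ F := fun h => hne (hcon X h)
  have hPs : P (F.card + 1) := by
    refine ⟨insert X F, ?_, ?_, Finset.card_insert_of_notMem hXF⟩
    · rw [Finset.coe_insert]
      exact insert_subset hX hF
    · rw [Finset.coe_insert]
      exact hd.insert fun Y hY _ => hcon Y hY
  have := Nat.le_findGreatest (hPb _ hPs) hPs
  omega

lemma comparable_of_not_disjoint {m : ℕ} {ε : ℝ} (hε : 0 < ε) {X Y : Euc m × ℝ}
    (h : ¬ Disjoint (farPairs ε X) (farPairs ε Y)) :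
    X.2 < 2 * Y.2 / ε ∧ ε * Y.2 / 2 < X.2 ∧ dist X.1 Y.1 < X.2 + Y.2 := by
  obtain ⟨p, ⟨⟨h1, h2⟩, h3⟩, ⟨h4, h5⟩, h6⟩ := not_disjoint_iff.1 h
  rw [mem_ball] at h1 h2 h4 h5
  rw [mem_ofPred_eq] at h3 h6
  have h7 := dist_triangle_right p.1 p.2 X.1
  have h8 := dist_triangle_right p.1 p.2 Y.1
  have h9 := dist_triangle_left X.1 Y.1 p.1
  refine ⟨?_, by linarith, by linarith⟩
  rw [lt_div_iff₀ hε]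
  linarith

lemma gapPotential_le {m ν : ℕ} {δ : ℝ} (hδ : 0 < δ) (u : Euc m → Euc ν) :
    gapPotential m ν δ u ≤ ENNReal.ofReal ((δ ^ (m + 1))⁻¹) * gagliardoEnergy m ν u := by
  unfold gapPotential gagliardoEnergy
  rw [← lintegral_const_mul' _ _ ENNReal.ofReal_ne_top]
  refine lintegral_mono fun x => ?_
  rw [← lintegral_const_mul' _ _ ENNReal.ofReal_ne_top]
  refine lintegral_mono fun y => ?_
  dsimp only
  split_ifs with h
  · rw [div_eq_mul_inv, ← mul_assoc, ← ENNReal.ofReal_mul (by positivity)]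
    refine le_mul_of_one_le_left zero_le ?_
    rw [ENNReal.one_le_ofReal, inv_mul_eq_div, one_le_div (by positivity)]
    gcongr
  · exact zero_le

/-- The numerator of the Gagliardo energy. -/
def powDiff {m ν : ℕ} (u : Euc m → Euc ν) (p : Euc m × Euc m) : ℝ≥0∞ :=
  ENNReal.ofReal (dist (u p.1) (u p.2) ^ (m + 1))

lemma measurable_powDiff {m ν : ℕ} {u : Euc m → Euc ν} (hu : Measurable u) :
    Measurable (powDiff u) := by
  unfold powDiff; fun_prop

lemma gagliardoEnergy_eq {m ν : ℕ} {u : Euc m → Euc ν} (hu : Measurable u) :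
    gagliardoEnergy m ν u = ∫⁻ p : Euc m × Euc m,
      powDiff u p / ENNReal.ofReal (dist p.1 p.2 ^ (2 * m)) := by
  rw [Measure.volume_eq_prod, lintegral_prod]
  · rfl
  · exact ((measurable_powDiff hu).div (by fun_prop)).aemeasurable

lemma le_add_inv_pow_mul_pow {a η : ℝ} (ha : 0 ≤ a) (hη : 0 < η) (m : ℕ) :
    a ≤ η + (η ^ m)⁻¹ * a ^ (m + 1) := by
  rcases le_total a η with h | h
  · have : 0 ≤ (η ^ m)⁻¹ * a ^ (m + 1) := by positivity
    linarith
  · have h1 : a ≤ (η ^ m)⁻¹ * a ^ (m + 1) := by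
      rw [inv_mul_eq_div, le_div_iff₀ (by positivity), pow_succ, mul_comm]
      gcongr
    linarith

lemma enorm_sub_le_powDiff {m ν : ℕ} (u : Euc m → Euc ν) {η : ℝ} (hη : 0 < η)
    (p : Euc m × Euc m) :
    ‖u p.2 - u p.1‖ₑ ≤ ENNReal.ofReal η + ENNReal.ofReal ((η ^ m)⁻¹) * powDiff u p := by
  rw [← ofReal_norm, ← dist_eq_norm, dist_comm, powDiff, ← ENNReal.ofReal_mul (by positivity),
    ← ENNReal.ofReal_add (by positivity) (by positivity)]
  exact ENNReal.ofReal_le_ofReal (le_add_inv_pow_mul_pow dist_nonneg hη m)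

lemma osc_le_powDiff {m ν : ℕ} {u : Euc m → Euc ν} (hu : Measurable u) {η : ℝ} (hη : 0 < η)
    (x : Euc m) {r : ℝ} (hr : 0 < r) :
    osc u x r ≤ ENNReal.ofReal (η * (r ^ m * unitVol m) ^ 2) +
      ENNReal.ofReal ((η ^ m)⁻¹) * ∫⁻ p in ball x r ×ˢ ball x r, powDiff u p := by
  have hω := unitVol_pos m
  rw [osc_eq_setLIntegral hu, ← lintegral_const_mul _ (measurable_powDiff hu)]
  refine (lintegral_mono fun p => enorm_sub_le_powDiff u hη p).trans (le_of_eq ?_)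
  rw [lintegral_add_left measurable_const, setLIntegral_const, Measure.volume_eq_prod,
    Measure.prod_prod, volume_ball_euc x hr, ← ENNReal.ofReal_mul (by positivity),
    ← ENNReal.ofReal_mul hη.le]
  congr 2; ring

/-- The constant of the pointwise estimate behind the weak-type bound. -/
def weakConst (m : ℕ) (K : ℝ) : ℝ := 2 * K * (2 * K * 4 ^ m * unitVol m ^ 2) ^ m

lemma pow_le_of_le_osc {m ν : ℕ} {u : Euc m → Euc ν} (hu : Measurable u) {K t : ℝ} (hK : 0 < K)
    (ht : 0 < t) {X : Euc m × ℝ} (hX : 0 < X.2)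
    (h : ENNReal.ofReal t ≤ ENNReal.ofReal (K / X.2 ^ (2 * m + 1)) * osc u X.1 (2 * X.2)) :
    ENNReal.ofReal (t ^ (m + 1)) ≤ ENNReal.ofReal (weakConst m K * (X.2 ^ (3 * m + 1))⁻¹) *
      ∫⁻ p in ball X.1 (2 * X.2) ×ˢ ball X.1 (2 * X.2), powDiff u p := by
  have hω := unitVol_pos m
  set κ := 2 * K * 4 ^ m * unitVol m ^ 2 with hκ
  have hκ0 : 0 < κ := by positivity
  have hw : 0 < weakConst m K * (X.2 ^ (3 * m + 1))⁻¹ := by unfold weakConst; positivity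
  set I := ∫⁻ p in ball X.1 (2 * X.2) ×ˢ ball X.1 (2 * X.2), powDiff u p with hI'
  by_cases hI : I = ⊤
  · rw [hI, ENNReal.mul_top (by simpa using hw)]; exact le_top
  obtain ⟨J, hJ0, hJ⟩ : ∃ J : ℝ, 0 ≤ J ∧ I = ENNReal.ofReal J :=
    ⟨I.toReal, ENNReal.toReal_nonneg, (ENNReal.ofReal_toReal hI).symm⟩
  have hη : 0 < X.2 * t / κ := by positivity
  have h1 := h.trans (mul_le_mul' le_rfl
    (osc_le_powDiff hu hη X.1 (r := 2 * X.2) (by positivity)))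
  rw [← hI', hJ, ← ENNReal.ofReal_mul (by positivity), ← ENNReal.ofReal_add (by positivity)
    (by positivity), ← ENNReal.ofReal_mul (by positivity),
    ENNReal.ofReal_le_ofReal_iff (by positivity)] at h1
  rw [hJ, ← ENNReal.ofReal_mul hw.le]
  refine ENNReal.ofReal_le_ofReal ?_
  have h2 : K / X.2 ^ (2 * m + 1) * (X.2 * t / κ * ((2 * X.2) ^ m * unitVol m) ^ 2) = t / 2 := by
    have h4 : (4 : ℝ) ^ m = (2 ^ m) ^ 2 := by rw [← pow_mul, mul_comm, pow_mul]; norm_num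
    rw [hκ, h4, mul_pow]; field_simp; ring
  rw [mul_add, h2] at h1
  have h3 : t ≤ 2 * (K / X.2 ^ (2 * m + 1) * (((X.2 * t / κ) ^ m)⁻¹ * J)) := by linarith
  calc t ^ (m + 1) = t ^ m * t := pow_succ _ _
    _ ≤ t ^ m * (2 * (K / X.2 ^ (2 * m + 1) * (((X.2 * t / κ) ^ m)⁻¹ * J))) := by gcongr
    _ = _ := by
      unfold weakConst
      rw [← hκ, div_pow, mul_pow, show 3 * m + 1 = m + (2 * m + 1) by ring, pow_add X.2 m]
      field_simp

/-- The kernel obtained by integrating out the pairs in a ball. -/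
def pairKernel {m : ℕ} (X : Euc m × ℝ) (p : Euc m × Euc m) : ℝ≥0∞ :=
  if 0 < X.2 ∧ dist p.1 X.1 < 2 * X.2 ∧ dist p.2 X.1 < 2 * X.2 then
    ENNReal.ofReal ((X.2 ^ (3 * m + 1))⁻¹) else 0

lemma measurable_pairKernel {m : ℕ} :
    Measurable fun q : (Euc m × ℝ) × (Euc m × Euc m) => pairKernel q.1 q.2 := by
  unfold pairKernel
  refine Measurable.ite ?_ (by fun_prop) measurable_const
  have h1 : MeasurableSet {q : (Euc m × ℝ) × (Euc m × Euc m) | 0 < q.1.2} :=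
    measurableSet_lt measurable_const (by fun_prop)
  have h2 : MeasurableSet {q : (Euc m × ℝ) × (Euc m × Euc m) |
      dist q.2.1 q.1.1 < 2 * q.1.2} :=
    measurableSet_lt (f := fun q : (Euc m × ℝ) × (Euc m × Euc m) => dist q.2.1 q.1.1)
      (by fun_prop) (by fun_prop)
  have h3 : MeasurableSet {q : (Euc m × ℝ) × (Euc m × Euc m) |
      dist q.2.2 q.1.1 < 2 * q.1.2} :=
    measurableSet_lt (f := fun q : (Euc m × ℝ) × (Euc m × Euc m) => dist q.2.2 q.1.1)
      (by fun_prop) (by fun_prop)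
  exact h1.inter (h2.inter h3)

lemma lintegral_Ioi_inv_pow {m : ℕ} (hm : 1 ≤ m) {r : ℝ} (hr : 0 < r) :
    ∫⁻ s in Ioi r, ENNReal.ofReal ((s ^ (2 * m + 1))⁻¹) =
      ENNReal.ofReal ((r ^ (2 * m))⁻¹ / (2 * m)) := by
  have hm' : (1 : ℝ) ≤ m := by exact_mod_cast hm
  have ha : -(2 * m + 1 : ℝ) < -1 := by linarith
  have hcongr : ∀ s ∈ Ioi r, (s ^ (2 * m + 1))⁻¹ = s ^ (-(2 * m + 1 : ℝ)) := fun s hs => by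
    rw [Real.rpow_neg (hr.trans hs).le]
    congr 1
    exact_mod_cast (Real.rpow_natCast s (2 * m + 1)).symm
  have h_integrable := integrableOn_Ioi_rpow_of_lt ha hr
  rw [setLIntegral_congr_fun measurableSet_Ioi
    (fun s hs => congrArg ENNReal.ofReal (hcongr s hs)),
    ← ofReal_integral_eq_lintegral_ofReal h_integrable, integral_Ioi_rpow_of_lt ha hr]
  · congr 1
    rw [show -(2 * m + 1 : ℝ) + 1 = -((2 * m : ℕ) : ℝ) by push_cast; ring,
      Real.rpow_neg hr.le, Real.rpow_natCast]
    push_cast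
    rw [neg_div_neg_eq]
  · filter_upwards [ae_restrict_mem measurableSet_Ioi] with s hs
    exact Real.rpow_nonneg (hr.trans hs).le _

lemma lintegral_pairKernel_le {m : ℕ} (hm : 1 ≤ m) {p : Euc m × Euc m}
    (hp : 0 < dist p.1 p.2) :
    ∫⁻ X, pairKernel X p ≤
      ENNReal.ofReal (2 ^ m * unitVol m * 4 ^ (2 * m)) /
        ENNReal.ofReal (dist p.1 p.2 ^ (2 * m)) := by
  have hω := unitVol_pos m
  have hm' : (1 : ℝ) ≤ m := by exact_mod_cast hm
  have hmeas : Measurable fun X : Euc m × ℝ => pairKernel X p :=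
    measurable_pairKernel.comp (measurable_id.prodMk measurable_const)
  rw [Measure.volume_eq_prod, lintegral_prod_symm _ hmeas.aemeasurable]
  set r := dist p.1 p.2 / 4 with hr
  have hr0 : 0 < r := by positivity
  calc ∫⁻ s, ∫⁻ x, pairKernel (x, s) p
      ≤ ∫⁻ s in Ioi r, ENNReal.ofReal (2 ^ m * unitVol m) *
          ENNReal.ofReal ((s ^ (2 * m + 1))⁻¹) := by
        rw [← lintegral_indicator measurableSet_Ioi]
        refine lintegral_mono fun s => ?_
        by_cases hs : s ∈ Ioi r
        · rw [indicator_of_mem hs]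
          have hs0 : 0 < s := hr0.trans hs
          calc ∫⁻ x, pairKernel (x, s) p
              ≤ ∫⁻ x, (ball p.1 (2 * s)).indicator
                  (fun _ => ENNReal.ofReal ((s ^ (3 * m + 1))⁻¹)) x := by
                refine lintegral_mono fun x => ?_
                unfold pairKernel
                split_ifs with h
                · rw [indicator_of_mem (mem_ball'.2 h.2.1)]
                · exact zero_le
            _ = _ := by
                rw [lintegral_indicator_const measurableSet_ball,
                  volume_ball_euc _ (by positivity), ← ENNReal.ofReal_mul (by positivity),
                  ← ENNReal.ofReal_mul (by positivity)]
                congr 1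
                rw [mul_pow, show 3 * m + 1 = m + (2 * m + 1) by ring, pow_add s m]
                field_simp
        · rw [indicator_of_notMem hs]
          refine le_of_eq ((lintegral_congr fun x => if_neg ?_).trans lintegral_zero)
          rintro ⟨_, h2, h3⟩
          apply hs
          simp only at h2 h3
          rw [mem_Ioi, hr]
          linarith [dist_triangle_right p.1 p.2 x]
    _ = ENNReal.ofReal (2 ^ m * unitVol m * ((r ^ (2 * m))⁻¹ / (2 * m))) := by
        rw [lintegral_const_mul' _ _ ENNReal.ofReal_ne_top, lintegral_Ioi_inv_pow hm hr0,
          ← ENNReal.ofReal_mul (by positivity)]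
    _ ≤ _ := by
        rw [← ENNReal.ofReal_div_of_pos (by positivity)]
        refine ENNReal.ofReal_le_ofReal ?_
        rw [hr, div_pow, inv_div, mul_div_assoc]
        exact mul_le_mul_of_nonneg_left (div_le_self (by positivity) (by linarith))
          (by positivity)

lemma weak_type_osc {m ν : ℕ} (hm : 1 ≤ m) {u : Euc m → Euc ν} (hu : Measurable u) {K t : ℝ}
    (hK : 0 < K) (ht : 0 < t) :
    ENNReal.ofReal (t ^ (m + 1)) * volume {X : Euc m × ℝ | 0 < X.2 ∧
      ENNReal.ofReal t ≤ ENNReal.ofReal (K / X.2 ^ (2 * m + 1)) * osc u X.1 (2 * X.2)} ≤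
    ENNReal.ofReal (weakConst m K * (2 ^ m * unitVol m * 4 ^ (2 * m))) *
      gagliardoEnergy m ν u := by
  have hω := unitVol_pos m
  have hw : 0 < weakConst m K := by unfold weakConst; positivity
  have hPm := measurable_powDiff hu
  have hKm : Measurable fun q : (Euc m × ℝ) × (Euc m × Euc m) =>
      pairKernel q.1 q.2 * powDiff u q.2 :=
    measurable_pairKernel.mul (hPm.comp measurable_snd)
  let f : Euc m × ℝ → ℝ≥0∞ := fun X =>
    ENNReal.ofReal (weakConst m K) * ∫⁻ p, pairKernel X p * powDiff u p
  have hf : Measurable f := (hKm.lintegral_prod_right').const_mul _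
  have hsub : {X : Euc m × ℝ | 0 < X.2 ∧
      ENNReal.ofReal t ≤ ENNReal.ofReal (K / X.2 ^ (2 * m + 1)) * osc u X.1 (2 * X.2)} ⊆
      {X | ENNReal.ofReal (t ^ (m + 1)) ≤ f X} := by
    rintro X ⟨hX, h⟩
    refine (pow_le_of_le_osc hu hK ht hX h).trans (le_of_eq ?_)
    rw [ENNReal.ofReal_mul hw.le, mul_assoc, ← lintegral_const_mul _ hPm,
      ← lintegral_indicator (measurableSet_ball.prod measurableSet_ball)]
    refine congrArg _ (lintegral_congr fun p => ?_)
    unfold pairKernel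
    by_cases hp : p ∈ ball X.1 (2 * X.2) ×ˢ ball X.1 (2 * X.2)
    · rw [indicator_of_mem hp, if_pos ⟨hX, mem_ball.1 hp.1, mem_ball.1 hp.2⟩]
    · rw [indicator_of_notMem hp, if_neg fun h => hp ⟨h.2.1, h.2.2⟩, zero_mul]
  refine (mul_le_mul' le_rfl (measure_mono hsub)).trans
    ((mul_meas_ge_le_lintegral₀ hf.aemeasurable _).trans ?_)
  rw [lintegral_const_mul' _ _ ENNReal.ofReal_ne_top, lintegral_lintegral_swap hKm.aemeasurable,
    ENNReal.ofReal_mul hw.le, mul_assoc]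
  refine mul_le_mul' le_rfl ?_
  rw [gagliardoEnergy_eq hu, ← lintegral_const_mul' _ _ ENNReal.ofReal_ne_top]
  refine lintegral_mono fun p => ?_
  have hmeas : Measurable fun X : Euc m × ℝ => pairKernel X p :=
    measurable_pairKernel.comp (measurable_id.prodMk measurable_const)
  rw [lintegral_mul_const _ hmeas]
  rcases eq_or_lt_of_le (dist_nonneg (x := p.1) (y := p.2)) with h0 | h0
  · have : powDiff u p = 0 := by
      rw [eq_comm, dist_eq_zero] at h0
      simp [powDiff, h0]
    simp [this]
  · refine (mul_le_mul' (lintegral_pairKernel_le hm h0) le_rfl).trans (le_of_eq ?_)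
    simp only [div_eq_mul_inv]
    ring

/-- A centre and a radius describing a ball whose closure lies in the half-space. -/
def IsInnerBall {m : ℕ} (b : (Euc m × ℝ) × ℝ) : Prop := 0 < b.2 ∧ 0 < b.1.2 - b.2

/-- Twice the quotient of the largest and the smallest height in a ball. -/
def heightRatio {m : ℕ} (b : (Euc m × ℝ) × ℝ) : ℝ := 2 * (1 + 2 * b.2 / (b.1.2 - b.2))

lemma IsInnerBall.one_le_heightRatio {m : ℕ} {b : (Euc m × ℝ) × ℝ} (hb : IsInnerBall b) :
    1 ≤ heightRatio b := by
  have : 0 ≤ 2 * b.2 / (b.1.2 - b.2) := div_nonneg (by linarith [hb.1]) hb.2.le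
  unfold heightRatio
  linarith

lemma exists_merge_of_le {m : ℕ} {b b' : (Euc m × ℝ) × ℝ} (hb : IsInnerBall b)
    (hb' : IsInnerBall b') (hle : b.1.2 - b.2 ≤ b'.1.2 - b'.2)
    (h : ¬ Disjoint (closedBall b.1 b.2) (closedBall b'.1 b'.2)) :
    ∃ B : (Euc m × ℝ) × ℝ, IsInnerBall B ∧ ball b.1 b.2 ⊆ ball B.1 B.2 ∧
      ball b'.1 b'.2 ⊆ ball B.1 B.2 ∧ heightRatio B ≤ heightRatio b * heightRatio b' := by
  obtain ⟨⟨x, a⟩, r⟩ := b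
  obtain ⟨⟨x', a'⟩, r'⟩ := b'
  obtain ⟨hr, ha⟩ := hb
  obtain ⟨hr', ha'⟩ := hb'
  obtain ⟨⟨y, s⟩, hy, hy'⟩ := not_disjoint_iff.1 h
  simp only [mem_closedBall, Prod.dist_eq, max_le_iff, Real.dist_eq, abs_le] at *
  have hx : dist x' x ≤ r + r' := by linarith [dist_triangle_left x' x y]
  refine ⟨((x, a - r + (r + 2 * r')), r + 2 * r'), ⟨by simp only; linarith, by simp only; linarith⟩,
    ?_, ?_, ?_⟩
  · rintro ⟨z, t⟩ hz
    simp only [mem_ball, Prod.dist_eq, max_lt_iff, Real.dist_eq, abs_lt] at *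
    refine ⟨by linarith, by linarith, by linarith⟩
  · rintro ⟨z, t⟩ hz
    simp only [mem_ball, Prod.dist_eq, max_lt_iff, Real.dist_eq, abs_lt] at *
    refine ⟨by linarith [dist_triangle z x' x], by linarith, by linarith⟩
  · unfold heightRatio
    simp only
    rw [show a - r + (r + 2 * r') - (r + 2 * r') = a - r by ring]
    have h1 : 2 * r' / (a - r) ≤ (1 + 2 * r / (a - r)) * (2 * r' / (a' - r')) := by
      rw [add_div' _ _ _ ha.ne', div_mul_div_comm, div_le_div_iff₀ ha (by positivity),
        one_mul]
      have : a' - r' ≤ a - r + 2 * r := by linarith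
      have := mul_le_mul_of_nonneg_left this (by positivity : 0 ≤ 2 * r' * (a - r))
      linarith
    have h2 : 0 ≤ 2 * r / (a - r) := by positivity
    have h3 : 2 * (r + 2 * r') / (a - r) = 2 * r / (a - r) + 2 * (2 * r' / (a - r)) := by ring
    rw [h3]
    nlinarith

lemma exists_merge {m : ℕ} {b b' : (Euc m × ℝ) × ℝ} (hb : IsInnerBall b)
    (hb' : IsInnerBall b')
    (h : ¬ Disjoint (closedBall b.1 b.2) (closedBall b'.1 b'.2)) :
    ∃ B : (Euc m × ℝ) × ℝ, IsInnerBall B ∧ ball b.1 b.2 ⊆ ball B.1 B.2 ∧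
      ball b'.1 b'.2 ⊆ ball B.1 B.2 ∧ heightRatio B ≤ heightRatio b * heightRatio b' := by
  rcases le_total (b.1.2 - b.2) (b'.1.2 - b'.2) with hle | hle
  · exact exists_merge_of_le hb hb' hle h
  · obtain ⟨B, h1, h2, h3, h4⟩ := exists_merge_of_le hb' hb hle fun h' => h h'.symm
    exact ⟨B, h1, h3, h2, h4.trans (mul_comm _ _).le⟩

lemma exists_disjoint_balls {m : ℕ} (n : ℕ) : ∀ T : Finset ((Euc m × ℝ) × ℝ), T.card = n →
    (∀ b ∈ T, IsInnerBall b) → ∃ T' : Finset ((Euc m × ℝ) × ℝ), T'.card ≤ n ∧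
      (∀ b ∈ T', IsInnerBall b) ∧
      (T' : Set ((Euc m × ℝ) × ℝ)).PairwiseDisjoint (fun b => closedBall b.1 b.2) ∧
      (∀ b ∈ T, ∃ b' ∈ T', ball b.1 b.2 ⊆ ball b'.1 b'.2) ∧
      ∀ b ∈ T', heightRatio b ≤ ∏ c ∈ T, heightRatio c := by
  classical
  induction n using Nat.strong_induction_on with
  | _ n ih =>
  intro T hT hin
  have hone : ∀ R ⊆ T, 1 ≤ ∏ c ∈ R, heightRatio c := fun R hR =>
    Finset.one_le_prod fun c hc => (hin c (hR hc)).one_le_heightRatio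
  by_cases hd : (T : Set ((Euc m × ℝ) × ℝ)).PairwiseDisjoint (fun b => closedBall b.1 b.2)
  · refine ⟨T, hT.le, hin, hd, fun b hb => ⟨b, hb, subset_rfl⟩, fun b hb => ?_⟩
    rw [← Finset.mul_prod_erase _ _ hb]
    exact le_mul_of_one_le_right (zero_le_one.trans (hin b hb).one_le_heightRatio)
      (hone _ (Finset.erase_subset _ _))
  · simp only [PairwiseDisjoint, Set.Pairwise, not_forall, Function.onFun] at hd
    obtain ⟨b, hb, b', hb', hne, hnd⟩ := hd
    rw [Finset.mem_coe] at hb hb'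
    obtain ⟨B, hB, hbB, hb'B, hratio⟩ := exists_merge (hin b hb) (hin b' hb') hnd
    have hb'' : b' ∈ T.erase b := Finset.mem_erase.2 ⟨hne.symm, hb'⟩
    set R := (T.erase b).erase b' with hR
    have hRT : R ⊆ T := (Finset.erase_subset _ _).trans (Finset.erase_subset _ _)
    have hRcard : R.card + 2 = n := by
      have h1 := Finset.card_erase_add_one hb
      have h2 := Finset.card_erase_add_one hb''
      rw [← hR] at h2
      omega
    have hcard : (insert B R).card < n := by
      have := Finset.card_insert_le B R
      omega
    obtain ⟨T', h1, h2, h3, h4, h5⟩ := ih _ hcard (insert B R) rfl fun c hc => by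
      rcases Finset.mem_insert.1 hc with rfl | hc
      · exact hB
      · exact hin c (hRT hc)
    refine ⟨T', by omega, h2, h3, fun c hc => ?_, fun c hc => (h5 c hc).trans ?_⟩
    · obtain ⟨B', hB', hsub⟩ := h4 B (Finset.mem_insert_self _ _)
      by_cases hcb : c = b
      · exact ⟨B', hB', hcb ▸ hbB.trans hsub⟩
      by_cases hcb' : c = b'
      · exact ⟨B', hB', hcb' ▸ hb'B.trans hsub⟩
      exact h4 c (Finset.mem_insert_of_mem
        (Finset.mem_erase.2 ⟨hcb', Finset.mem_erase.2 ⟨hcb, hc⟩⟩))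
    · have h6 : ∏ c ∈ insert B R, heightRatio c ≤ heightRatio B * ∏ c ∈ R, heightRatio c := by
        by_cases hBR : B ∈ R
        · rw [Finset.insert_eq_of_mem hBR]
          exact le_mul_of_one_le_left (zero_le_one.trans (hone R hRT)) hB.one_le_heightRatio
        · rw [Finset.prod_insert hBR]
      refine h6.trans ?_
      rw [← Finset.mul_prod_erase _ _ hb, ← Finset.mul_prod_erase _ _ hb'', ← mul_assoc]
      exact mul_le_mul_of_nonneg_right hratio (zero_le_one.trans (hone R hRT))

section Lipschitz

variable {E F G : Type*} [NormedAddCommGroup E] [NormedAddCommGroup F] [NormedAddCommGroup G]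

/-- `f` is Lipschitz in a neighbourhood of `x`. -/
def LipschitzNear (f : E → F) (x : E) : Prop :=
  ∃ C : ℝ, 0 ≤ C ∧ ∃ s ∈ 𝓝 x, ∀ y ∈ s, ∀ z ∈ s, ‖f y - f z‖ ≤ C * ‖y - z‖

/-- `f` is calm at `x` with constant `C`. -/
def CalmAt (f : E → F) (C : ℝ) (x : E) : Prop :=
  ∀ᶠ y in 𝓝 x, ‖f y - f x‖ ≤ C * ‖y - x‖

lemma CalmAt.continuousAt {f : E → F} {C : ℝ} {x : E} (h : CalmAt f C x) :
    ContinuousAt f x := by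
  rw [ContinuousAt, tendsto_iff_norm_sub_tendsto_zero]
  have h0 : Tendsto (fun y => C * ‖y - x‖) (𝓝 x) (𝓝 0) := by
    have : ContinuousAt (fun y => C * ‖y - x‖) x := by fun_prop
    simpa [ContinuousAt] using this
  exact squeeze_zero' (Eventually.of_forall fun _ => norm_nonneg _) h h0

lemma LipschitzNear.exists_calmAt {f : E → F} {x : E} (h : LipschitzNear f x) :
    ∃ C, CalmAt f C x := by
  obtain ⟨C, -, s, hs, h⟩ := h
  exact ⟨C, mem_of_superset hs fun y hy => h y hy x (mem_of_mem_nhds hs)⟩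

lemma LipschitzNear.continuousAt {f : E → F} {x : E} (h : LipschitzNear f x) :
    ContinuousAt f x :=
  h.exists_calmAt.choose_spec.continuousAt

lemma LipschitzNear.comp {g : F → G} {f : E → F} {x : E} (hg : LipschitzNear g (f x))
    (hf : LipschitzNear f x) : LipschitzNear (fun y => g (f y)) x := by
  have hc := hf.continuousAt
  obtain ⟨C, hC, s, hs, h⟩ := hf
  obtain ⟨C', hC', s', hs', h'⟩ := hg
  refine ⟨C' * C, by positivity, s ∩ f ⁻¹' s', inter_mem hs (hc hs'), fun y hy z hz => ?_⟩
  refine (h' _ hy.2 _ hz.2).trans ?_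
  rw [mul_assoc]
  exact mul_le_mul_of_nonneg_left (h y hy.1 z hz.1) hC'

lemma CalmAt.comp {g : F → G} {f : E → F} {x : E} {C C' : ℝ} (hC' : 0 ≤ C')
    (hg : CalmAt g C' (f x)) (hf : CalmAt f C x) :
    CalmAt (fun y => g (f y)) (C' * C) x := by
  filter_upwards [hf, hf.continuousAt.eventually hg] with y h1 h2
  rw [mul_assoc]
  exact h2.trans (mul_le_mul_of_nonneg_left h1 hC')

lemma LipschitzNear.congr {f g : E → F} {x : E} (hf : LipschitzNear f x) (h : g =ᶠ[𝓝 x] f) :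
    LipschitzNear g x := by
  obtain ⟨C, hC, s, hs, hC'⟩ := hf
  refine ⟨C, hC, s ∩ {y | g y = f y}, inter_mem hs h, fun y hy z hz => ?_⟩
  rw [show g y = f y from hy.2, show g z = f z from hz.2]
  exact hC' y hy.1 z hz.1

lemma CalmAt.congr {f g : E → F} {x : E} {C : ℝ} (hf : CalmAt f C x) (h : g =ᶠ[𝓝 x] f) :
    CalmAt g C x := by
  filter_upwards [hf, h] with y h1 h2
  rwa [h2, h.eq_of_nhds]

lemma lipschitzNear_id (x : E) : LipschitzNear (fun y : E => y) x :=
  ⟨1, zero_le_one, univ, univ_mem, fun y _ z _ => by simp⟩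

lemma eventually_notMem_closedBall {T : Finset (E × ℝ)} {x : E}
    (hx : ∀ b ∈ T, x ∉ closedBall b.1 b.2) :
    ∀ᶠ y in 𝓝 x, ∀ b ∈ T, y ∉ closedBall b.1 b.2 := by
  rw [Finset.eventually_all]
  exact fun b hb => isClosed_closedBall.isOpen_compl.mem_nhds (hx b hb)

variable [NormedSpace ℝ E] [NormedSpace ℝ F]

lemma CalmAt.norm_fderiv_le {f : E → F} {x : E} {C : ℝ} (hC : 0 ≤ C) (h : CalmAt f C x)
    (hd : DifferentiableAt ℝ f x) : ‖fderiv ℝ f x‖ ≤ C :=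
  hd.hasFDerivAt.le_of_lip' hC h

lemma ae_differentiableAt_of_lipschitzNear [FiniteDimensional ℝ E] [FiniteDimensional ℝ F]
    [MeasurableSpace E] [BorelSpace E] (μ : Measure E) [μ.IsAddHaarMeasure] {f : E → F}
    {Ω : Set E} (h : ∀ x ∈ Ω, LipschitzNear f x) :
    ∀ᵐ x ∂μ, x ∈ Ω → DifferentiableAt ℝ f x := by
  have : μ {x | x ∈ Ω ∧ ¬ DifferentiableAt ℝ f x} = 0 := by
    refine measure_null_of_locally_null _ fun x hx => ?_
    obtain ⟨C, hC, s, hs, hC'⟩ := h x hx.1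
    obtain ⟨t, hts, ht, hxt⟩ := _root_.mem_nhds_iff.1 hs
    have hL : LipschitzOnWith ⟨C, hC⟩ f t := LipschitzOnWith.of_dist_le_mul fun y hy z hz => by
      rw [dist_eq_norm, dist_eq_norm]; exact hC' y (hts hy) z (hts hz)
    refine ⟨{x | x ∈ Ω ∧ ¬ DifferentiableAt ℝ f x} ∩ t,
      inter_mem_nhdsWithin _ (ht.mem_nhds hxt), ?_⟩
    refine measure_mono_null ?_ (ae_iff.1 (hL.ae_differentiableWithinAt_of_mem (μ := μ)))
    rintro y ⟨⟨-, h1⟩, h2⟩ hy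
    exact h1 ((hy h2).differentiableAt (ht.mem_nhds h2))
  rw [ae_iff]
  convert this using 2
  ext x
  simp

/-- The radial map pushing the ball of centre `c` and radius `r` onto its boundary sphere. -/
def radialPush (c : E) (r : ℝ) (x : E) : E := c + max 1 (r / ‖x - c‖) • (x - c)

lemma radialPush_of_le {c : E} {r : ℝ} (hr : 0 < r) {x : E} (h : r ≤ ‖x - c‖) :
    radialPush c r x = x := by
  unfold radialPush
  rw [max_eq_left ((div_le_one (hr.trans_le h)).2 h)]
  simp

lemma norm_radialPush_sub {c : E} {r : ℝ} {x : E} (hx : x ≠ c) (h : ‖x - c‖ ≤ r) :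
    ‖radialPush c r x - c‖ = r := by
  have h0 : 0 < ‖x - c‖ := norm_pos_iff.2 (sub_ne_zero.2 hx)
  unfold radialPush
  rw [max_eq_right ((one_le_div h0).2 h), add_sub_cancel_left, norm_smul, Real.norm_eq_abs,
    abs_of_nonneg (div_nonneg (h0.le.trans h) h0.le), div_mul_cancel₀ _ h0.ne']

lemma norm_radialPush_sub_le {c : E} {r : ℝ} (hr : 0 ≤ r) {x y : E} (hx : x ≠ c) (hy : y ≠ c) :
    ‖radialPush c r x - radialPush c r y‖ ≤ (1 + 2 * r / ‖x - c‖) * ‖x - y‖ := by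
  have hx0 : 0 < ‖x - c‖ := norm_pos_iff.2 (sub_ne_zero.2 hx)
  have hy0 : 0 < ‖y - c‖ := norm_pos_iff.2 (sub_ne_zero.2 hy)
  have key : radialPush c r x - radialPush c r y = max 1 (r / ‖x - c‖) • (x - y) +
      (max 1 (r / ‖x - c‖) - max 1 (r / ‖y - c‖)) • (y - c) := by
    unfold radialPush; module
  have h1 : |max 1 (r / ‖x - c‖) - max 1 (r / ‖y - c‖)| ≤ |r / ‖x - c‖ - r / ‖y - c‖| := by
    rw [max_comm 1, max_comm 1]; exact abs_max_sub_max_le_abs _ _ _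
  have h2 : |r / ‖x - c‖ - r / ‖y - c‖| * ‖y - c‖ ≤ r / ‖x - c‖ * ‖x - y‖ := by
    have h3 : |‖y - c‖ - ‖x - c‖| ≤ ‖x - y‖ := by
      have := abs_norm_sub_norm_le (y - c) (x - c)
      rwa [sub_sub_sub_cancel_right, norm_sub_rev y x] at this
    have h4 : r / ‖x - c‖ - r / ‖y - c‖ = r / ‖x - c‖ * ((‖y - c‖ - ‖x - c‖) / ‖y - c‖) := by
      field_simp
    rw [h4, abs_mul, abs_of_nonneg (by positivity : 0 ≤ r / ‖x - c‖), abs_div, abs_norm,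
      mul_assoc, div_mul_cancel₀ _ hy0.ne']
    gcongr
  have h5 : max 1 (r / ‖x - c‖) ≤ 1 + r / ‖x - c‖ :=
    max_le (by linarith [div_nonneg hr hx0.le]) (by linarith)
  rw [key]
  refine (norm_add_le _ _).trans ?_
  rw [norm_smul, norm_smul, Real.norm_eq_abs, Real.norm_eq_abs,
    abs_of_nonneg (zero_le_one.trans (le_max_left _ _))]
  calc _ ≤ (1 + r / ‖x - c‖) * ‖x - y‖ + |r / ‖x - c‖ - r / ‖y - c‖| * ‖y - c‖ := by gcongr
    _ ≤ (1 + r / ‖x - c‖) * ‖x - y‖ + r / ‖x - c‖ * ‖x - y‖ := by gcongr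
    _ = _ := by ring

lemma calmAt_radialPush {c : E} {r : ℝ} (hr : 0 ≤ r) {x : E} (hx : x ≠ c) :
    CalmAt (radialPush c r) (1 + 2 * r / ‖x - c‖) x := by
  filter_upwards [isOpen_ne.mem_nhds hx] with y hy
  rw [norm_sub_rev, norm_sub_rev y]
  exact norm_radialPush_sub_le hr hx hy

lemma lipschitzNear_radialPush {c : E} {r : ℝ} (hr : 0 ≤ r) {x : E} (hx : x ≠ c) :
    LipschitzNear (radialPush c r) x := by
  have hx0 : 0 < ‖x - c‖ := norm_pos_iff.2 (sub_ne_zero.2 hx)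
  have hc : ContinuousAt (fun y : E => ‖y - c‖) x := by fun_prop
  have h2 : 0 < ‖x - c‖ / 2 := by positivity
  refine ⟨1 + 2 * r / (‖x - c‖ / 2), by positivity, {y | ‖x - c‖ / 2 < ‖y - c‖},
    hc.eventually (lt_mem_nhds (by linarith)), fun y hy z hz => ?_⟩
  have hne : ∀ y : E, ‖x - c‖ / 2 < ‖y - c‖ → y ≠ c := fun y hy =>
    sub_ne_zero.1 (norm_pos_iff.1 (h2.trans hy))
  refine (norm_radialPush_sub_le hr (hne y hy) (hne z hz)).trans ?_
  have : ‖x - c‖ / 2 ≤ ‖y - c‖ := le_of_lt hy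
  gcongr

open Classical in
/-- The map pushing every ball of the family radially onto its boundary sphere. -/
def ballCollapse (T : Finset (E × ℝ)) (x : E) : E :=
  if h : ∃ b ∈ T, x ∈ closedBall b.1 b.2 then radialPush h.choose.1 h.choose.2 x else x

lemma ballCollapse_of_mem {T : Finset (E × ℝ)}
    (hd : (T : Set (E × ℝ)).PairwiseDisjoint fun b => closedBall b.1 b.2) {b : E × ℝ}
    (hb : b ∈ T) {x : E} (hx : x ∈ closedBall b.1 b.2) :
    ballCollapse T x = radialPush b.1 b.2 x := by
  have h : ∃ b ∈ T, x ∈ closedBall b.1 b.2 := ⟨b, hb, hx⟩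
  have heq : h.choose = b := by
    by_contra hne
    exact not_disjoint_iff.2 ⟨x, h.choose_spec.2, hx⟩ (hd h.choose_spec.1 hb hne)
  rw [ballCollapse, dif_pos h, heq]

lemma ballCollapse_of_notMem {T : Finset (E × ℝ)} {x : E}
    (hx : ∀ b ∈ T, x ∉ closedBall b.1 b.2) : ballCollapse T x = x := by
  rw [ballCollapse, dif_neg]
  rintro ⟨b, hb, h⟩
  exact hx b hb h

lemma ballCollapse_eventuallyEq_id {T : Finset (E × ℝ)} {x : E}
    (hx : ∀ b ∈ T, x ∉ closedBall b.1 b.2) : ballCollapse T =ᶠ[𝓝 x] fun y => y := by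
  filter_upwards [eventually_notMem_closedBall hx] with y hy
  exact ballCollapse_of_notMem hy

lemma ballCollapse_eventuallyEq_radialPush {T : Finset (E × ℝ)}
    (hd : (T : Set (E × ℝ)).PairwiseDisjoint fun b => closedBall b.1 b.2) {b : E × ℝ}
    (hb : b ∈ T) (hr : 0 < b.2) {x : E} (hx : x ∈ closedBall b.1 b.2) :
    ballCollapse T =ᶠ[𝓝 x] radialPush b.1 b.2 := by
  classical
  have h : ∀ᶠ y in 𝓝 x, ∀ b' ∈ T.erase b, y ∉ closedBall b'.1 b'.2 := by
    refine eventually_notMem_closedBall fun b' hb' hx' => ?_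
    obtain ⟨hne, hb'⟩ := Finset.mem_erase.1 hb'
    exact not_disjoint_iff.2 ⟨x, hx', hx⟩ (hd hb' hb hne)
  filter_upwards [h] with y hy
  by_cases hyb : y ∈ closedBall b.1 b.2
  · exact ballCollapse_of_mem hd hb hyb
  · rw [ballCollapse_of_notMem, radialPush_of_le hr]
    · rw [mem_closedBall, not_le, dist_eq_norm] at hyb
      exact hyb.le
    · intro b' hb'
      by_cases h' : b' = b
      · rwa [h']
      · exact hy b' (Finset.mem_erase.2 ⟨h', hb'⟩)

lemma lipschitzNear_ballCollapse {T : Finset (E × ℝ)}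
    (hd : (T : Set (E × ℝ)).PairwiseDisjoint fun b => closedBall b.1 b.2)
    (hr : ∀ b ∈ T, 0 < b.2) {x : E} (hx : ∀ b ∈ T, x ≠ b.1) :
    LipschitzNear (ballCollapse T) x := by
  by_cases h : ∃ b ∈ T, x ∈ closedBall b.1 b.2
  · obtain ⟨b, hb, hxb⟩ := h
    exact (lipschitzNear_radialPush (hr b hb).le (hx b hb)).congr
      (ballCollapse_eventuallyEq_radialPush hd hb (hr b hb) hxb)
  · push Not at h
    exact (lipschitzNear_id x).congr (ballCollapse_eventuallyEq_id h)

lemma ballCollapse_notMem_ball {T : Finset (E × ℝ)}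
    (hd : (T : Set (E × ℝ)).PairwiseDisjoint fun b => closedBall b.1 b.2)
    {x : E} (hx : ∀ b ∈ T, x ≠ b.1) :
    ∀ b ∈ T, ballCollapse T x ∉ ball b.1 b.2 := by
  intro b hb hxb
  by_cases h : ∃ b ∈ T, x ∈ closedBall b.1 b.2
  · obtain ⟨b', hb', hxb'⟩ := h
    rw [ballCollapse_of_mem hd hb' hxb'] at hxb
    have h1 := norm_radialPush_sub (hx b' hb') (mem_closedBall_iff_norm.1 hxb')
    by_cases hbb : b = b'
    · subst hbb
      rw [mem_ball_iff_norm, h1] at hxb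
      exact lt_irrefl _ hxb
    · exact not_disjoint_iff.2 ⟨_, ball_subset_closedBall hxb, mem_closedBall_iff_norm.2 h1.le⟩
        (hd hb hb' hbb)
  · push Not at h
    rw [ballCollapse_of_notMem h] at hxb
    exact h b hb (ball_subset_closedBall hxb)

end Lipschitz

section Retraction

variable {F : Type*} [NormedAddCommGroup F] [NormedSpace ℝ F] {N : Set F} {ρ L : ℝ} {P : F → F}

lemma norm_retraction_sub_le (hP : ContDiffOn ℝ 1 P {y | infDist y N < ρ})
    (hL : ∀ y ∈ {y | infDist y N < ρ}, ‖fderiv ℝ P y‖ ≤ L) {s : Set F} (hs : Convex ℝ s)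
    (hsO : s ⊆ {y | infDist y N < ρ}) {y z : F} (hy : y ∈ s) (hz : z ∈ s) :
    ‖P y - P z‖ ≤ L * ‖y - z‖ := by
  have hO : IsOpen {y | infDist y N < ρ} :=
    isOpen_lt (continuous_infDist_pt N) continuous_const
  refine hs.norm_image_sub_le_of_norm_fderiv_le (𝕜 := ℝ) (fun x hx => ?_)
    (fun x hx => hL x (hsO hx)) hz hy
  exact (hP.differentiableOn one_ne_zero).differentiableAt (hO.mem_nhds (hsO hx))

lemma exists_ball_norm_retraction_sub_le (hP : ContDiffOn ℝ 1 P {y | infDist y N < ρ})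
    (hL : ∀ y ∈ {y | infDist y N < ρ}, ‖fderiv ℝ P y‖ ≤ L) {x : F} (hx : infDist x N < ρ) :
    ∃ s ∈ 𝓝 x, ∀ y ∈ s, ∀ z ∈ s, ‖P y - P z‖ ≤ L * ‖y - z‖ := by
  have hO : IsOpen {y | infDist y N < ρ} :=
    isOpen_lt (continuous_infDist_pt N) continuous_const
  obtain ⟨r, hr, h⟩ := Metric.isOpen_iff.1 hO x hx
  exact ⟨ball x r, ball_mem_nhds x hr, fun y hy z hz =>
    norm_retraction_sub_le hP hL (convex_ball x r) h hy hz⟩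

lemma lipschitzNear_retraction (hP : ContDiffOn ℝ 1 P {y | infDist y N < ρ})
    (hL0 : 0 ≤ L) (hL : ∀ y ∈ {y | infDist y N < ρ}, ‖fderiv ℝ P y‖ ≤ L) {x : F}
    (hx : infDist x N < ρ) : LipschitzNear P x := by
  obtain ⟨s, hs, h⟩ := exists_ball_norm_retraction_sub_le hP hL hx
  exact ⟨L, hL0, s, hs, h⟩

lemma calmAt_retraction (hP : ContDiffOn ℝ 1 P {y | infDist y N < ρ})
    (hL : ∀ y ∈ {y | infDist y N < ρ}, ‖fderiv ℝ P y‖ ≤ L) {x : F}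
    (hx : infDist x N < ρ) : CalmAt P L x := by
  obtain ⟨s, hs, h⟩ := exists_ball_norm_retraction_sub_le hP hL hx
  exact mem_of_superset hs fun y hy => h y hy x (mem_of_mem_nhds hs)

/-- Retracting a point onto `N` moves it away from a given point of `N` by at most a fixed
multiple of the original distance. -/
lemma norm_retraction_sub_le_of_mem (hρ : 0 < ρ) {D : ℝ} (hD0 : 0 ≤ D)
    (hD : ∀ a ∈ N, ∀ b ∈ N, ‖a - b‖ ≤ D)
    (hP : ContDiffOn ℝ 1 P {y | infDist y N < ρ})
    (hL : ∀ y ∈ {y | infDist y N < ρ}, ‖fderiv ℝ P y‖ ≤ L)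
    (hmaps : ∀ y ∈ {y | infDist y N < ρ}, P y ∈ N) (hid : ∀ y ∈ N, P y = y)
    {x a : F} (hx : infDist x N < ρ) (ha : a ∈ N) :
    ‖P x - a‖ ≤ max L (D / ρ) * ‖x - a‖ := by
  by_cases h : ‖x - a‖ < ρ
  · have hsub : ball a ρ ⊆ {y | infDist y N < ρ} := fun y hy =>
      (infDist_le_dist_of_mem ha).trans_lt hy
    have := norm_retraction_sub_le hP hL (convex_ball a ρ) hsub (mem_ball_iff_norm.2 h)
      (mem_ball_self hρ)
    rw [hid a ha] at this
    exact this.trans (mul_le_mul_of_nonneg_right (le_max_left _ _) (norm_nonneg _))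
  · push Not at h
    calc ‖P x - a‖ ≤ D := hD _ (hmaps x hx) _ ha
      _ = D / ρ * ρ := by field_simp
      _ ≤ max L (D / ρ) * ‖x - a‖ :=
        mul_le_mul (le_max_right _ _) h hρ.le (le_max_of_le_right (by positivity))

end Retraction

section Average

variable {m ν : ℕ} {u : Euc m → Euc ν} {D₀ D : ℝ}

lemma dist_mem_ball_sixth {X X₁ X₂ : Euc m × ℝ} (h₁ : X₁ ∈ ball X (X.2 / 6))
    (h₂ : X₂ ∈ ball X (X.2 / 6)) : 5 * X.2 / 6 ≤ X₁.2 ∧ dist X₁ X₂ ≤ X₁.2 / 2 := by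
  have h3 : |X₁.2 - X.2| < X.2 / 6 :=
    ((Real.dist_eq _ _).symm.le.trans (le_max_right _ _)).trans_lt h₁
  have h4 := dist_triangle_right X₁ X₂ X
  rw [mem_ball] at h₁ h₂
  rw [abs_lt] at h3
  constructor <;> linarith

lemma lipschitzNear_coneAverage (hu : Measurable u) (hD₀ : ∀ z, ‖u z‖ ≤ D₀)
    (hD0 : 0 ≤ D) (hD : ∀ y z, ‖u y - u z‖ ≤ D) {X : Euc m × ℝ} (hX : 0 < X.2) :
    LipschitzNear (coneAverage u) X := by
  have hl := lipConst_nonneg m hD0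
  refine ⟨lipConst m D / (5 * X.2 / 6), by positivity, ball X (X.2 / 6),
    ball_mem_nhds X (by positivity), fun Y hY Z hZ => ?_⟩
  obtain ⟨h1, h2⟩ := dist_mem_ball_sixth hY hZ
  refine (norm_coneAverage_sub_coneAverage_le hu hD₀ hD (by linarith) h2).trans ?_
  rw [dist_eq_norm]
  gcongr

lemma calmAt_coneAverage (hu : Measurable u) (hD₀ : ∀ z, ‖u z‖ ≤ D₀)
    (hD : ∀ y z, ‖u y - u z‖ ≤ D) {X : Euc m × ℝ} (hX : 0 < X.2) :
    CalmAt (coneAverage u) (lipConst m D / X.2) X := by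
  filter_upwards [ball_mem_nhds X (half_pos hX)] with Y hY
  rw [norm_sub_rev, norm_sub_rev Y, ← dist_eq_norm X Y]
  exact norm_coneAverage_sub_coneAverage_le hu hD₀ hD hX
    (by rw [dist_comm]; exact (mem_ball.1 hY).le)

lemma calmAt_coneAverage_osc (hu : Measurable u) (hD₀ : ∀ z, ‖u z‖ ≤ D₀)
    (hD : ∀ y z, ‖u y - u z‖ ≤ D) {X : Euc m × ℝ} (hX : 0 < X.2) :
    CalmAt (coneAverage u)
      (2 ^ (m + 1) * avgConst m ^ 2 / X.2 ^ (2 * m + 1) * (osc u X.1 (2 * X.2)).toReal) X := by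
  have hfin : osc u X.1 (2 * X.2) ≠ ⊤ :=
    ((osc_le hD X.1 (by positivity)).trans_lt ENNReal.ofReal_lt_top).ne
  have ha := avgConst_pos m
  filter_upwards [ball_mem_nhds X (half_pos hX)] with Y hY
  have h := enorm_coneAverage_sub_coneAverage_le hu hD₀ hX (Y := Y)
    (by rw [dist_comm]; exact (mem_ball.1 hY).le)
  rw [← ENNReal.ofReal_toReal hfin, ← ENNReal.ofReal_mul (by positivity),
    ← ofReal_norm, ENNReal.ofReal_le_ofReal_iff (by positivity)] at h
  rw [norm_sub_rev, norm_sub_rev Y, ← dist_eq_norm X Y]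
  exact h.trans_eq (by ring)

end Average

/-- A lower bound for the gap potential generated by a point where the cone average is far from
the target. -/
def badMass (m : ℕ) (D ρ : ℝ) : ℝ := ρ * unitVol m / (2 * D * avgConst m * 2 ^ (2 * m))

lemma badMass_pos (m : ℕ) {D ρ : ℝ} (hD : 0 < D) (hρ : 0 < ρ) : 0 < badMass m D ρ := by
  have := unitVol_pos m
  have := avgConst_pos m
  unfold badMass
  positivity

lemma gapThreshold_pos (m : ℕ) {D ρ : ℝ} (hD : 0 < D) (hρ : 0 < ρ) : 0 < gapThreshold m D ρ := by
  have := unitVol_pos m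
  have := avgConst_pos m
  unfold gapThreshold
  exact lt_min one_pos (by positivity)

/-- The height ratio of the ball `ballAbove δ X`. -/
def coverRatio (δ : ℝ) : ℝ := 2 * (1 + 2 * ((1 + 2 / δ) * (2 / δ)))

lemma one_le_coverRatio {δ : ℝ} (hδ : 0 < δ) : 1 ≤ coverRatio δ := by
  have : 0 ≤ 2 * ((1 + 2 / δ) * (2 / δ)) := by positivity
  unfold coverRatio
  linarith

/-- A ball compactly contained in the half-space and containing all the points whose height and
horizontal distance are comparable to those of `X`. -/
def ballAbove {m : ℕ} (δ : ℝ) (X : Euc m × ℝ) : (Euc m × ℝ) × ℝ :=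
  ((X.1, δ * X.2 / 2 + (1 + 2 / δ) * X.2), (1 + 2 / δ) * X.2)

lemma isInnerBall_ballAbove {m : ℕ} {δ : ℝ} (hδ : 0 < δ) {X : Euc m × ℝ} (hX : 0 < X.2) :
    IsInnerBall (ballAbove δ X) := by
  refine ⟨?_, ?_⟩
  · change 0 < (1 + 2 / δ) * X.2
    positivity
  · change 0 < δ * X.2 / 2 + (1 + 2 / δ) * X.2 - (1 + 2 / δ) * X.2
    rw [add_sub_cancel_right]
    positivity

lemma heightRatio_ballAbove {m : ℕ} {δ : ℝ} (hδ : 0 < δ) {X : Euc m × ℝ} (hX : 0 < X.2) :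
    heightRatio (ballAbove δ X) = coverRatio δ := by
  simp only [heightRatio, ballAbove, coverRatio, add_sub_cancel_right]
  field_simp

lemma mem_ball_ballAbove {m : ℕ} {δ : ℝ} (hδ : 0 < δ) {X Y : Euc m × ℝ} (hY : 0 < Y.2)
    (h : X.2 < 2 * Y.2 / δ ∧ δ * Y.2 / 2 < X.2 ∧ dist X.1 Y.1 < X.2 + Y.2) :
    X ∈ ball (ballAbove δ Y).1 (ballAbove δ Y).2 := by
  obtain ⟨h1, h2, h3⟩ := h
  have h4 : (1 + 2 / δ) * Y.2 = Y.2 + 2 * Y.2 / δ := by ring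
  have h5 : 0 < δ * Y.2 / 2 := by positivity
  simp only [ballAbove, mem_ball, Prod.dist_eq, max_lt_iff, Real.dist_eq, abs_lt, h4]
  refine ⟨by linarith, by linarith, by linarith⟩

section Covering

variable {m ν : ℕ} {u : Euc m → Euc ν} {N : Set (Euc ν)} {D₀ D ρ : ℝ}

/-- The points where the cone average is far from the target are covered by a controlled number
of disjoint balls of controlled height ratio. -/
lemma exists_balls_cover (hm : 1 ≤ m) (hu : Measurable u) (hρ : 0 < ρ) (hD1 : 0 < D)
    (hD₀ : ∀ z, ‖u z‖ ≤ D₀) (hD : ∀ y z, ‖u y - u z‖ ≤ D) (hN : ∀ z, u z ∈ N)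
    (hG : gapPotential m ν (gapThreshold m D ρ) u ≠ ⊤) :
    ∃ (k : ℕ) (T : Finset ((Euc m × ℝ) × ℝ)),
      (k : ℝ≥0∞) * ENNReal.ofReal (badMass m D ρ) ≤ gapPotential m ν (gapThreshold m D ρ) u ∧
      T.card ≤ k ∧ (∀ b ∈ T, IsInnerBall b) ∧
      (T : Set ((Euc m × ℝ) × ℝ)).PairwiseDisjoint (fun b => closedBall b.1 b.2) ∧
      (∀ b ∈ T, heightRatio b ≤ coverRatio (gapThreshold m D ρ) ^ k) ∧
      ∀ X : Euc m × ℝ, 0 < X.2 → ρ ≤ infDist (coneAverage u X) N →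
        ∃ b ∈ T, X ∈ ball b.1 b.2 := by
  classical
  set δ := gapThreshold m D ρ with hδ_def
  have hδ : 0 < δ := gapThreshold_pos m hD1 hρ
  have hc : ENNReal.ofReal (badMass m D ρ) ≠ 0 :=
    (ENNReal.ofReal_pos.2 (badMass_pos m hD1 hρ)).ne'
  obtain ⟨F, hFbad, hFcard, hF⟩ := exists_maximal_finset (u := u) (δ := δ)
    (bad := {X | 0 < X.2 ∧ ρ ≤ infDist (coneAverage u X) N}) hu hc hG
    fun X hX => le_setLIntegral_gapKernel hm hu hρ hD1 hD₀ hD hN hX.1 hX.2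
  have himage : ∀ b ∈ F.image (ballAbove δ), IsInnerBall b ∧ heightRatio b = coverRatio δ := by
    intro b hb
    obtain ⟨Y, hY, rfl⟩ := Finset.mem_image.1 hb
    exact ⟨isInnerBall_ballAbove hδ (hFbad hY).1, heightRatio_ballAbove hδ (hFbad hY).1⟩
  obtain ⟨T, hT1, hT2, hT3, hT4, hT5⟩ := exists_disjoint_balls _ (F.image (ballAbove δ)) rfl
    fun b hb => (himage b hb).1
  refine ⟨F.card, T, hFcard, hT1.trans Finset.card_image_le, hT2, hT3, fun b hb => ?_,
    fun X hX hbad => ?_⟩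
  · refine (hT5 b hb).trans ?_
    rw [Finset.prod_congr rfl fun c hc => (himage c hc).2, Finset.prod_const]
    exact pow_le_pow_right₀ (one_le_coverRatio hδ) Finset.card_image_le
  · obtain ⟨Y, hY, hXY⟩ := hF X ⟨hX, hbad⟩
    obtain ⟨b, hb, hsub⟩ := hT4 _ (Finset.mem_image_of_mem (ballAbove δ) hY)
    exact ⟨b, hb, hsub (mem_ball_ballAbove hδ (hFbad hY).1 (comparable_of_not_disjoint hδ hXY))⟩

end Covering

open Classical in
/-- The composition of the retraction `P` with the cone average of `u`, precomposed with the
collapse of the balls of the family `T` onto their boundaries; the value at the centres of the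
balls is the prescribed point `a`. -/
def singularExtension {m ν : ℕ} (P : Euc ν → Euc ν) (a : Euc ν) (u : Euc m → Euc ν)
    (T : Finset ((Euc m × ℝ) × ℝ)) (X : Euc m × ℝ) : Euc ν :=
  if ∃ b ∈ T, X = b.1 then a else P (coneAverage u (ballCollapse T X))

section Extension

variable {m ν : ℕ} {u : Euc m → Euc ν} {N : Set (Euc ν)} {D₀ D ρ L H : ℝ}
  {P : Euc ν → Euc ν} {a : Euc ν} {T : Finset ((Euc m × ℝ) × ℝ)} {X : Euc m × ℝ}

lemma singularExtension_of_ne (hX : ∀ b ∈ T, X ≠ b.1) :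
    singularExtension P a u T X = P (coneAverage u (ballCollapse T X)) := by
  rw [singularExtension, if_neg]
  rintro ⟨b, hb, h⟩
  exact hX b hb h

lemma eventually_ne_centers (hX : ∀ b ∈ T, X ≠ b.1) : ∀ᶠ Y in 𝓝 X, ∀ b ∈ T, Y ≠ b.1 := by
  rw [Finset.eventually_all]
  exact fun b hb => isOpen_ne.mem_nhds (hX b hb)

lemma singularExtension_eventuallyEq (hX : ∀ b ∈ T, X ≠ b.1) :
    singularExtension P a u T =ᶠ[𝓝 X] fun Y => P (coneAverage u (ballCollapse T Y)) := by
  filter_upwards [eventually_ne_centers hX] with Y hY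
  exact singularExtension_of_ne hY

lemma height_le_of_mem_closedBall {b : (Euc m × ℝ) × ℝ} (h : X ∈ closedBall b.1 b.2) :
    b.1.2 - b.2 ≤ X.2 := by
  have h3 : |X.2 - b.1.2| ≤ b.2 := ((Real.dist_eq _ _).symm.le.trans (le_max_right _ _)).trans h
  rw [abs_le] at h3
  linarith

lemma radialPush_mem_closedBall {b : (Euc m × ℝ) × ℝ} (hne : X ≠ b.1)
    (h : X ∈ closedBall b.1 b.2) : radialPush b.1 b.2 X ∈ closedBall b.1 b.2 :=
  mem_closedBall_iff_norm.2 (norm_radialPush_sub hne (mem_closedBall_iff_norm.1 h)).le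

lemma ballCollapse_height_pos (hin : ∀ b ∈ T, IsInnerBall b)
    (hd : (T : Set ((Euc m × ℝ) × ℝ)).PairwiseDisjoint fun b => closedBall b.1 b.2)
    (hX : 0 < X.2) (hne : ∀ b ∈ T, X ≠ b.1) : 0 < (ballCollapse T X).2 := by
  by_cases h : ∃ b ∈ T, X ∈ closedBall b.1 b.2
  · obtain ⟨b, hb, hXb⟩ := h
    rw [ballCollapse_of_mem hd hb hXb]
    exact (hin b hb).2.trans_le
      (height_le_of_mem_closedBall (radialPush_mem_closedBall (hne b hb) hXb))
  · push Not at h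
    rwa [ballCollapse_of_notMem h]

lemma infDist_coneAverage_ballCollapse_lt (hin : ∀ b ∈ T, IsInnerBall b)
    (hd : (T : Set ((Euc m × ℝ) × ℝ)).PairwiseDisjoint fun b => closedBall b.1 b.2)
    (hcov : ∀ X : Euc m × ℝ, 0 < X.2 → ρ ≤ infDist (coneAverage u X) N →
      ∃ b ∈ T, X ∈ ball b.1 b.2)
    (hX : 0 < X.2) (hne : ∀ b ∈ T, X ≠ b.1) :
    infDist (coneAverage u (ballCollapse T X)) N < ρ := by
  by_contra! h
  obtain ⟨b, hb, hXb⟩ := hcov _ (ballCollapse_height_pos hin hd hX hne) h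
  exact ballCollapse_notMem_ball hd hne b hb hXb

lemma singularExtension_mem (hin : ∀ b ∈ T, IsInnerBall b)
    (hd : (T : Set ((Euc m × ℝ) × ℝ)).PairwiseDisjoint fun b => closedBall b.1 b.2)
    (hcov : ∀ X : Euc m × ℝ, 0 < X.2 → ρ ≤ infDist (coneAverage u X) N →
      ∃ b ∈ T, X ∈ ball b.1 b.2)
    (hmaps : ∀ y ∈ {y | infDist y N < ρ}, P y ∈ N) (ha : a ∈ N) (hX : 0 < X.2) :
    singularExtension P a u T X ∈ N := by
  by_cases h : ∃ b ∈ T, X = b.1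
  · rwa [singularExtension, if_pos h]
  · push Not at h
    rw [singularExtension_of_ne h]
    exact hmaps _ (infDist_coneAverage_ballCollapse_lt hin hd hcov hX h)

lemma lipschitzNear_singularExtension (hu : Measurable u) (hD₀ : ∀ z, ‖u z‖ ≤ D₀) (hD0 : 0 ≤ D)
    (hD : ∀ y z, ‖u y - u z‖ ≤ D) (hP : ContDiffOn ℝ 1 P {y | infDist y N < ρ})
    (hL0 : 0 ≤ L) (hL : ∀ y ∈ {y | infDist y N < ρ}, ‖fderiv ℝ P y‖ ≤ L)
    (hin : ∀ b ∈ T, IsInnerBall b)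
    (hd : (T : Set ((Euc m × ℝ) × ℝ)).PairwiseDisjoint fun b => closedBall b.1 b.2)
    (hcov : ∀ X : Euc m × ℝ, 0 < X.2 → ρ ≤ infDist (coneAverage u X) N →
      ∃ b ∈ T, X ∈ ball b.1 b.2)
    (hX : 0 < X.2) (hne : ∀ b ∈ T, X ≠ b.1) :
    LipschitzNear (singularExtension P a u T) X := by
  refine LipschitzNear.congr ?_ (singularExtension_eventuallyEq hne)
  have h1 := lipschitzNear_ballCollapse hd (fun b hb => (hin b hb).1) hne
  have h2 := lipschitzNear_coneAverage hu hD₀ hD0 hD (ballCollapse_height_pos hin hd hX hne)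
  have h3 : LipschitzNear (fun Y => coneAverage u (ballCollapse T Y)) X := h2.comp h1
  exact LipschitzNear.comp (lipschitzNear_retraction hP hL0 hL
    (infDist_coneAverage_ballCollapse_lt hin hd hcov hX hne)) h3

lemma norm_fderiv_singularExtension_le_osc (hu : Measurable u) (hD₀ : ∀ z, ‖u z‖ ≤ D₀)
    (hD : ∀ y z, ‖u y - u z‖ ≤ D) (hP : ContDiffOn ℝ 1 P {y | infDist y N < ρ})
    (hL0 : 0 ≤ L) (hL : ∀ y ∈ {y | infDist y N < ρ}, ‖fderiv ℝ P y‖ ≤ L)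
    (hin : ∀ b ∈ T, IsInnerBall b)
    (hcov : ∀ X : Euc m × ℝ, 0 < X.2 → ρ ≤ infDist (coneAverage u X) N →
      ∃ b ∈ T, X ∈ ball b.1 b.2)
    (hX : 0 < X.2) (hout : ∀ b ∈ T, X ∉ closedBall b.1 b.2)
    (hdiff : DifferentiableAt ℝ (singularExtension P a u T) X) :
    ENNReal.ofReal ‖fderiv ℝ (singularExtension P a u T) X‖ ≤
      ENNReal.ofReal (L * (2 ^ (m + 1) * avgConst m ^ 2) / X.2 ^ (2 * m + 1)) *
        osc u X.1 (2 * X.2) := by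
  have hfin : osc u X.1 (2 * X.2) ≠ ⊤ :=
    ((osc_le hD X.1 (by positivity)).trans_lt ENNReal.ofReal_lt_top).ne
  have ha := avgConst_pos m
  have hne : ∀ b ∈ T, X ≠ b.1 := fun b hb h => hout b hb (by
    rw [h]; exact mem_closedBall_self (hin b hb).1.le)
  have hV : infDist (coneAverage u X) N < ρ := by
    by_contra! h
    obtain ⟨b, hb, hXb⟩ := hcov X hX h
    exact hout b hb (ball_subset_closedBall hXb)
  have h1 : singularExtension P a u T =ᶠ[𝓝 X] fun Y => P (coneAverage u Y) := by
    filter_upwards [singularExtension_eventuallyEq (P := P) (a := a) (u := u) hne,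
      ballCollapse_eventuallyEq_id hout] with Y h h'
    rw [h, h']
  have h2 := (((calmAt_retraction hP hL hV).comp hL0
    (calmAt_coneAverage_osc hu hD₀ hD hX)).congr h1).norm_fderiv_le (by positivity) hdiff
  rw [← ENNReal.ofReal_toReal hfin, ← ENNReal.ofReal_mul (by positivity)]
  exact ENNReal.ofReal_le_ofReal (h2.trans_eq (by ring))

lemma norm_fderiv_singularExtension_le_div (hu : Measurable u) (hD₀ : ∀ z, ‖u z‖ ≤ D₀)
    (hD0 : 0 ≤ D) (hD : ∀ y z, ‖u y - u z‖ ≤ D)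
    (hP : ContDiffOn ℝ 1 P {y | infDist y N < ρ})
    (hL0 : 0 ≤ L) (hL : ∀ y ∈ {y | infDist y N < ρ}, ‖fderiv ℝ P y‖ ≤ L)
    (hin : ∀ b ∈ T, IsInnerBall b)
    (hd : (T : Set ((Euc m × ℝ) × ℝ)).PairwiseDisjoint fun b => closedBall b.1 b.2)
    (hcov : ∀ X : Euc m × ℝ, 0 < X.2 → ρ ≤ infDist (coneAverage u X) N →
      ∃ b ∈ T, X ∈ ball b.1 b.2)
    (hX : 0 < X.2) (hne : ∀ b ∈ T, X ≠ b.1) {b : (Euc m × ℝ) × ℝ} (hb : b ∈ T)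
    (hXb : X ∈ closedBall b.1 b.2)
    (hdiff : DifferentiableAt ℝ (singularExtension P a u T) X) :
    ‖fderiv ℝ (singularExtension P a u T) X‖ ≤
      3 * L * lipConst m D * heightRatio b / ‖X - b.1‖ := by
  obtain ⟨hr, hα⟩ := hin b hb
  have hl := lipConst_nonneg m hD0
  have hXp : 0 < ‖X - b.1‖ := norm_pos_iff.2 (sub_ne_zero.2 (hne b hb))
  have hXr : ‖X - b.1‖ ≤ b.2 := mem_closedBall_iff_norm.1 hXb
  have hV := infDist_coneAverage_ballCollapse_lt hin hd hcov hX hne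
  have hpos := ballCollapse_height_pos hin hd hX hne
  rw [ballCollapse_of_mem hd hb hXb] at hV hpos
  have hlow := height_le_of_mem_closedBall (radialPush_mem_closedBall (hne b hb) hXb)
  have h1 : singularExtension P a u T =ᶠ[𝓝 X]
      fun Y => P (coneAverage u (radialPush b.1 b.2 Y)) := by
    filter_upwards [singularExtension_eventuallyEq (P := P) (a := a) (u := u) hne,
      ballCollapse_eventuallyEq_radialPush hd hb hr hXb] with Y h h'
    rw [h, h']
  have hl' : 0 ≤ lipConst m D / (radialPush b.1 b.2 X).2 := div_nonneg hl hpos.le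
  have hV' : CalmAt (fun Y => coneAverage u (radialPush b.1 b.2 Y))
      (lipConst m D / (radialPush b.1 b.2 X).2 * (1 + 2 * b.2 / ‖X - b.1‖)) X :=
    (calmAt_coneAverage hu hD₀ hD hpos).comp hl' (calmAt_radialPush hr.le (hne b hb))
  have hU : CalmAt (fun Y => P (coneAverage u (radialPush b.1 b.2 Y)))
      (L * (lipConst m D / (radialPush b.1 b.2 X).2 * (1 + 2 * b.2 / ‖X - b.1‖))) X :=
    CalmAt.comp hL0 (calmAt_retraction hP hL hV) hV'
  have h2 := (hU.congr h1).norm_fderiv_le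
    (mul_nonneg hL0 (mul_nonneg hl' (by positivity))) hdiff
  refine h2.trans ?_
  have h3 : 1 + 2 * b.2 / ‖X - b.1‖ ≤ 3 * b.2 / ‖X - b.1‖ := by
    have : 1 ≤ b.2 / ‖X - b.1‖ := (one_le_div hXp).2 hXr
    rw [mul_div_assoc, mul_div_assoc]
    linarith
  have h4 : b.2 / (b.1.2 - b.2) ≤ heightRatio b := by
    have : 0 ≤ b.2 / (b.1.2 - b.2) := by positivity
    unfold heightRatio
    rw [mul_div_assoc]
    linarith
  calc L * (lipConst m D / (radialPush b.1 b.2 X).2 * (1 + 2 * b.2 / ‖X - b.1‖))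
      ≤ L * (lipConst m D / (b.1.2 - b.2) * (3 * b.2 / ‖X - b.1‖)) := by gcongr
    _ = 3 * L * lipConst m D * (b.2 / (b.1.2 - b.2)) / ‖X - b.1‖ := by ring
    _ ≤ _ := by gcongr

instance isAddHaarMeasure_volume_euc_prod :
    (volume : Measure (Euc m × ℝ)).IsAddHaarMeasure :=
  inferInstanceAs ((volume : Measure (Euc m)).prod (volume : Measure ℝ)).IsAddHaarMeasure

lemma volume_closedBall_half_space (X : Euc m × ℝ) {r : ℝ} (hr : 0 ≤ r) :
    volume (closedBall X r) = ENNReal.ofReal (r ^ (m + 1)) *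
      volume (ball (0 : Euc m × ℝ) 1) := by
  rw [Measure.addHaar_closedBall _ _ hr]
  simp

lemma weak_type_singularExtension (hm : 1 ≤ m) (hu : Measurable u) (hD₀ : ∀ z, ‖u z‖ ≤ D₀)
    (hD0 : 0 ≤ D) (hD : ∀ y z, ‖u y - u z‖ ≤ D)
    (hP : ContDiffOn ℝ 1 P {y | infDist y N < ρ})
    (hL0 : 0 < L) (hL : ∀ y ∈ {y | infDist y N < ρ}, ‖fderiv ℝ P y‖ ≤ L)
    (hin : ∀ b ∈ T, IsInnerBall b)
    (hd : (T : Set ((Euc m × ℝ) × ℝ)).PairwiseDisjoint fun b => closedBall b.1 b.2)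
    (hcov : ∀ X : Euc m × ℝ, 0 < X.2 → ρ ≤ infDist (coneAverage u X) N →
      ∃ b ∈ T, X ∈ ball b.1 b.2)
    (hH0 : 0 ≤ H) (hH : ∀ b ∈ T, heightRatio b ≤ H) {t : ℝ} (ht : 0 < t) :
    ENNReal.ofReal (t ^ (m + 1)) *
        volume {X : Euc m × ℝ | 0 < X.2 ∧ DifferentiableAt ℝ (singularExtension P a u T) X ∧
          t ≤ ‖fderiv ℝ (singularExtension P a u T) X‖} ≤
      ENNReal.ofReal (weakConst m (L * (2 ^ (m + 1) * avgConst m ^ 2)) *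
        (2 ^ m * unitVol m * 4 ^ (2 * m))) * gagliardoEnergy m ν u +
      T.card * (ENNReal.ofReal ((3 * L * lipConst m D * H) ^ (m + 1)) *
        volume (ball (0 : Euc m × ℝ) 1)) := by
  have ha := avgConst_pos m
  have hl := lipConst_nonneg m hD0
  set R := 3 * L * lipConst m D * H with hR
  have hR0 : 0 ≤ R := by positivity
  have hsub : {X : Euc m × ℝ | 0 < X.2 ∧ DifferentiableAt ℝ (singularExtension P a u T) X ∧
      t ≤ ‖fderiv ℝ (singularExtension P a u T) X‖} ⊆
      {X | 0 < X.2 ∧ ENNReal.ofReal t ≤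
        ENNReal.ofReal (L * (2 ^ (m + 1) * avgConst m ^ 2) / X.2 ^ (2 * m + 1)) *
          osc u X.1 (2 * X.2)} ∪ ⋃ b ∈ T, closedBall b.1 (R / t) := by
    rintro X ⟨hX, hdiff, htX⟩
    by_cases hout : ∀ b ∈ T, X ∉ closedBall b.1 b.2
    · exact Or.inl ⟨hX, (ENNReal.ofReal_le_ofReal htX).trans
        (norm_fderiv_singularExtension_le_osc hu hD₀ hD hP hL0.le hL hin hcov hX hout hdiff)⟩
    · right
      rw [mem_iUnion₂]
      by_cases hne : ∀ b ∈ T, X ≠ b.1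
      · push Not at hout
        obtain ⟨b, hb, hXb⟩ := hout
        refine ⟨b, hb, ?_⟩
        have hXp : 0 < ‖X - b.1‖ := norm_pos_iff.2 (sub_ne_zero.2 (hne b hb))
        have h1 := htX.trans (norm_fderiv_singularExtension_le_div hu hD₀ hD0 hD hP hL0.le hL hin
          hd hcov hX hne hb hXb hdiff)
        have h2 : t ≤ R / ‖X - b.1‖ := h1.trans (by
          rw [hR]
          have := hH b hb
          gcongr)
        rw [mem_closedBall_iff_norm]
        rwa [le_div_iff₀ hXp, mul_comm, ← le_div_iff₀ ht] at h2
      · push Not at hne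
        obtain ⟨b, hb, rfl⟩ := hne
        exact ⟨b, hb, mem_closedBall_self (by positivity)⟩
  have hballs : ENNReal.ofReal (t ^ (m + 1)) *
      volume (⋃ b ∈ T, closedBall b.1 (R / t)) ≤
      T.card * (ENNReal.ofReal (R ^ (m + 1)) * volume (ball (0 : Euc m × ℝ) 1)) := by
    calc ENNReal.ofReal (t ^ (m + 1)) * volume (⋃ b ∈ T, closedBall b.1 (R / t))
        ≤ ENNReal.ofReal (t ^ (m + 1)) * ∑ b ∈ T, volume (closedBall b.1 (R / t)) := by
          gcongr
          exact measure_biUnion_finset_le _ _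
      _ = T.card * (ENNReal.ofReal (R ^ (m + 1)) * volume (ball (0 : Euc m × ℝ) 1)) := by
          rw [Finset.sum_congr rfl fun b _ => volume_closedBall_half_space b.1
            (by positivity : 0 ≤ R / t), Finset.sum_const, nsmul_eq_mul, mul_left_comm, ← mul_assoc
            (ENNReal.ofReal (t ^ (m + 1))), ← ENNReal.ofReal_mul (by positivity), ← mul_pow,
            mul_div_cancel₀ _ ht.ne']
  calc _ ≤ ENNReal.ofReal (t ^ (m + 1)) * (_ + _) :=
        mul_le_mul' le_rfl ((measure_mono hsub).trans (measure_union_le _ _))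
    _ ≤ _ := by
        rw [mul_add]
        exact add_le_add (weak_type_osc hm hu (by positivity) ht) hballs

end Extension

section Trace

variable {m ν : ℕ} {u : Euc m → Euc ν} {N : Set (Euc ν)} {D₀ D ρ L : ℝ}
  {P : Euc ν → Euc ν} {a : Euc ν} {T : Finset ((Euc m × ℝ) × ℝ)}

/-- The inner integral in the Gagliardo energy. -/
def energyDensity (u : Euc m → Euc ν) (y : Euc m) : ℝ≥0∞ :=
  ∫⁻ z, powDiff u (y, z) / ENNReal.ofReal (dist y z ^ (2 * m))

lemma measurable_energyDensity (hu : Measurable u) : Measurable (energyDensity u) := by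
  have h : Measurable fun p : Euc m × Euc m =>
      powDiff u p / ENNReal.ofReal (dist p.1 p.2 ^ (2 * m)) :=
    (measurable_powDiff hu).div (by fun_prop)
  exact h.lintegral_prod_right'

lemma powDiff_le_mul_div {y z : Euc m} {s : ℝ} (h : dist y z ≤ s) :
    powDiff u (y, z) ≤
      ENNReal.ofReal (s ^ (2 * m)) * (powDiff u (y, z) / ENNReal.ofReal (dist y z ^ (2 * m))) := by
  rcases eq_or_ne y z with rfl | hne
  · simp [powDiff]
  · have h0 : 0 < dist y z := dist_pos.2 hne
    calc powDiff u (y, z) = ENNReal.ofReal (dist y z ^ (2 * m)) *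
          (powDiff u (y, z) / ENNReal.ofReal (dist y z ^ (2 * m))) :=
          (ENNReal.mul_div_cancel (ENNReal.ofReal_pos.2 (by positivity)).ne'
            ENNReal.ofReal_ne_top).symm
      _ ≤ _ := by gcongr

lemma enorm_coneAverage_sub_base_le (hu : Measurable u) (hD₀ : ∀ z, ‖u z‖ ≤ D₀) {y : Euc m}
    {s η : ℝ} (hs : 0 < s) (hη : 0 < η) :
    ‖coneAverage u (y, s) - u y‖ₑ ≤ ENNReal.ofReal (avgConst m * unitVol m * η) +
      ENNReal.ofReal (avgConst m * (s ^ m * (η ^ m)⁻¹)) * energyDensity u y := by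
  have hA := avgConst_pos m
  refine (enorm_coneAverage_sub_le hu hD₀ (X := (y, s)) hs (u y)).trans ?_
  have h1 : ∫⁻ z in ball y s, ‖u z - u y‖ₑ ≤
      ENNReal.ofReal (η * (s ^ m * unitVol m)) +
        ENNReal.ofReal ((η ^ m)⁻¹ * s ^ (2 * m)) * energyDensity u y := by
    calc ∫⁻ z in ball y s, ‖u z - u y‖ₑ
        ≤ ∫⁻ z in ball y s, (ENNReal.ofReal η + ENNReal.ofReal ((η ^ m)⁻¹ * s ^ (2 * m)) *
            (powDiff u (y, z) / ENNReal.ofReal (dist y z ^ (2 * m)))) := by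
          refine setLIntegral_mono' measurableSet_ball fun z hz => ?_
          refine (enorm_sub_le_powDiff u hη (y, z)).trans (add_le_add le_rfl ?_)
          rw [ENNReal.ofReal_mul (by positivity), mul_assoc]
          exact mul_le_mul' le_rfl (powDiff_le_mul_div (mem_ball'.1 hz).le)
      _ ≤ _ := by
          rw [lintegral_add_left measurable_const, setLIntegral_const, volume_ball_euc y hs,
            ← ENNReal.ofReal_mul hη.le, lintegral_const_mul' _ _ ENNReal.ofReal_ne_top]
          exact add_le_add le_rfl (mul_le_mul' le_rfl (setLIntegral_le_lintegral _ _))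
  refine (mul_le_mul' le_rfl h1).trans_eq ?_
  have h0 : 0 ≤ avgConst m / s ^ m := by positivity
  change ENNReal.ofReal (avgConst m / s ^ m) * _ = _
  rw [mul_add, ← mul_assoc (ENNReal.ofReal (avgConst m / s ^ m)), ← ENNReal.ofReal_mul h0,
    ← ENNReal.ofReal_mul h0]
  have h2 : avgConst m / s ^ m * (η * (s ^ m * unitVol m)) = avgConst m * unitVol m * η := by
    field_simp
  have h3 : avgConst m / s ^ m * ((η ^ m)⁻¹ * s ^ (2 * m)) =
      avgConst m * (s ^ m * (η ^ m)⁻¹) := by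
    rw [two_mul, pow_add]
    field_simp
  rw [h2, h3]

lemma lintegral_coneAverage_sub_base_le (hu : Measurable u)
    (hD₀ : ∀ z, ‖u z‖ ≤ D₀) (K : Set (Euc m)) {ε : ℝ} (hε : 0 < ε) :
    ENNReal.ofReal ε⁻¹ * ∫⁻ X in K ×ˢ Ioo (0 : ℝ) ε, ‖coneAverage u X - u X.1‖ₑ ≤
      ENNReal.ofReal (avgConst m * unitVol m * √ε) * volume K +
        ENNReal.ofReal (avgConst m * √ε ^ m) * gagliardoEnergy m ν u := by
  have hA := avgConst_pos m
  have hη : 0 < √ε := Real.sqrt_pos.2 hε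
  have hηm : ε ^ m * (√ε ^ m)⁻¹ = √ε ^ m := by
    rw [mul_inv_eq_iff_eq_mul₀ (by positivity), ← mul_pow, Real.mul_self_sqrt hε.le]
  have hmeas := measurable_energyDensity hu
  let f : Euc m → ℝ≥0∞ := fun y => ENNReal.ofReal (avgConst m * unitVol m * √ε) +
    ENNReal.ofReal (avgConst m * √ε ^ m) * energyDensity u y
  have hf : Measurable f := (hmeas.const_mul _).const_add _
  have h1 : ∫⁻ X in K ×ˢ Ioo (0 : ℝ) ε, ‖coneAverage u X - u X.1‖ₑ ≤
      ∫⁻ X in K ×ˢ Ioo (0 : ℝ) ε, f X.1 := by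
    have hle : ∀ X ∈ (univ : Set (Euc m)) ×ˢ Ioo (0 : ℝ) ε,
        ‖coneAverage u X - u X.1‖ₑ ≤ f X.1 := by
      rintro ⟨y, s⟩ ⟨-, hs⟩
      refine (enorm_coneAverage_sub_base_le hu hD₀ hs.1 hη).trans ?_
      have : s ^ m * (√ε ^ m)⁻¹ ≤ √ε ^ m := by
        refine le_of_le_of_eq ?_ hηm
        have hs1 : 0 ≤ s := hs.1.le
        have hs2 : s ≤ ε := hs.2.le
        gcongr
      change _ ≤ ENNReal.ofReal (avgConst m * unitVol m * √ε) +
        ENNReal.ofReal (avgConst m * √ε ^ m) * energyDensity u y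
      gcongr
    refine lintegral_mono_ae ?_
    have : ∀ᵐ X ∂(volume.restrict ((univ : Set (Euc m)) ×ˢ Ioo (0 : ℝ) ε)),
        ‖coneAverage u X - u X.1‖ₑ ≤ f X.1 :=
      (ae_restrict_iff' (MeasurableSet.univ.prod measurableSet_Ioo)).2 (Eventually.of_forall hle)
    exact ae_restrict_of_ae_restrict_of_subset (prod_mono (subset_univ K) le_rfl) this
  have h2 : ∫⁻ X in K ×ˢ Ioo (0 : ℝ) ε, f X.1 = (∫⁻ y in K, f y) * ENNReal.ofReal ε := by
    rw [Measure.volume_eq_prod, ← Measure.prod_restrict]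
    have := lintegral_prod_mul (μ := volume.restrict K) (ν := volume.restrict (Ioo 0 ε))
      (g := fun _ => 1) hf.aemeasurable aemeasurable_const
    simpa using this
  calc _ ≤ ENNReal.ofReal ε⁻¹ * ((∫⁻ y in K, f y) * ENNReal.ofReal ε) :=
        mul_le_mul' le_rfl (h1.trans_eq h2)
    _ = ∫⁻ y in K, f y := by
        rw [mul_left_comm, ← ENNReal.ofReal_mul (by positivity), inv_mul_cancel₀ hε.ne',
          ENNReal.ofReal_one, mul_one]
    _ ≤ _ := by
        rw [lintegral_add_left measurable_const, setLIntegral_const, lintegral_const_mul _ hmeas]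
        exact add_le_add le_rfl (mul_le_mul' le_rfl (setLIntegral_le_lintegral _ _))

lemma tendsto_trace_singularExtension (hm : 1 ≤ m) (hu : Measurable u)
    (hD₀ : ∀ z, ‖u z‖ ≤ D₀) (hN : ∀ z, u z ∈ N) (hρ : 0 < ρ) (hD0 : 0 ≤ D)
    (hD : ∀ a ∈ N, ∀ b ∈ N, ‖a - b‖ ≤ D)
    (hP : ContDiffOn ℝ 1 P {y | infDist y N < ρ})
    (hL : ∀ y ∈ {y | infDist y N < ρ}, ‖fderiv ℝ P y‖ ≤ L)
    (hmaps : ∀ y ∈ {y | infDist y N < ρ}, P y ∈ N) (hid : ∀ y ∈ N, P y = y)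
    (hin : ∀ b ∈ T, IsInnerBall b)
    (hcov : ∀ X : Euc m × ℝ, 0 < X.2 → ρ ≤ infDist (coneAverage u X) N →
      ∃ b ∈ T, X ∈ ball b.1 b.2)
    (hE : gagliardoEnergy m ν u ≠ ⊤) {K : Set (Euc m)} (hK : IsCompact K) :
    Tendsto (fun ε : ℝ => ENNReal.ofReal ε⁻¹ *
      ∫⁻ X in K ×ˢ Ioo (0 : ℝ) ε, ENNReal.ofReal ‖singularExtension P a u T X - u X.1‖)
      (𝓝[>] 0) (𝓝 0) := by
  set C := max L (D / ρ)
  have hbound : Tendsto (fun ε : ℝ => ENNReal.ofReal C *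
      (ENNReal.ofReal (avgConst m * unitVol m * √ε) * volume K +
        ENNReal.ofReal (avgConst m * √ε ^ m) * gagliardoEnergy m ν u)) (𝓝[>] 0) (𝓝 0) := by
    refine Tendsto.mono_left ?_ nhdsWithin_le_nhds
    have h1 : Tendsto (fun ε : ℝ => ENNReal.ofReal (avgConst m * unitVol m * √ε)) (𝓝 0) (𝓝 0) := by
      have : ContinuousAt (fun ε : ℝ => ENNReal.ofReal (avgConst m * unitVol m * √ε)) 0 :=
        (ENNReal.continuous_ofReal.comp (by fun_prop)).continuousAt
      simpa [ContinuousAt] using this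
    have h2 : Tendsto (fun ε : ℝ => ENNReal.ofReal (avgConst m * √ε ^ m)) (𝓝 0) (𝓝 0) := by
      have : ContinuousAt (fun ε : ℝ => ENNReal.ofReal (avgConst m * √ε ^ m)) 0 :=
        (ENNReal.continuous_ofReal.comp (by fun_prop)).continuousAt
      simpa [ContinuousAt, zero_pow (by lia : m ≠ 0)] using this
    have h3 := ENNReal.Tendsto.mul_const h1
      (Or.inr (hK.measure_lt_top (μ := volume)).ne)
    have h4 := ENNReal.Tendsto.mul_const h2 (Or.inr hE)
    have h5 := ENNReal.Tendsto.const_mul (h3.add h4)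
      (Or.inr (ENNReal.ofReal_ne_top (r := C)))
    simpa using h5
  refine tendsto_of_tendsto_of_tendsto_of_le_of_le' tendsto_const_nhds hbound
    (Eventually.of_forall fun _ => zero_le) ?_
  have hlow : ∀ᶠ ε : ℝ in 𝓝[>] 0, ∀ b ∈ T, ε < b.1.2 - b.2 := by
    rw [Finset.eventually_all]
    exact fun b hb => nhdsWithin_le_nhds (gt_mem_nhds (hin b hb).2)
  filter_upwards [hlow, self_mem_nhdsWithin] with ε hε hε0
  have hpt : ∀ X ∈ K ×ˢ Ioo (0 : ℝ) ε,
      ENNReal.ofReal ‖singularExtension P a u T X - u X.1‖ ≤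
        ENNReal.ofReal C * ‖coneAverage u X - u X.1‖ₑ := by
    rintro X ⟨-, hX⟩
    have hout : ∀ b ∈ T, X ∉ closedBall b.1 b.2 := fun b hb h =>
      absurd (height_le_of_mem_closedBall h) (not_le.2 (hX.2.trans (hε b hb)))
    have hne : ∀ b ∈ T, X ≠ b.1 := fun b hb h => hout b hb (by
      rw [h]; exact mem_closedBall_self (hin b hb).1.le)
    have hV : infDist (coneAverage u X) N < ρ := by
      by_contra! h
      obtain ⟨b, hb, hXb⟩ := hcov X hX.1 h
      exact hout b hb (ball_subset_closedBall hXb)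
    rw [singularExtension_of_ne hne, ballCollapse_of_notMem hout, ← ofReal_norm,
      ← ENNReal.ofReal_mul (le_max_of_le_right (by positivity))]
    exact ENNReal.ofReal_le_ofReal
      (norm_retraction_sub_le_of_mem hρ hD0 hD hP hL hmaps hid hV (hN _))
  calc _ ≤ ENNReal.ofReal ε⁻¹ *
        ∫⁻ X in K ×ˢ Ioo (0 : ℝ) ε, ENNReal.ofReal C * ‖coneAverage u X - u X.1‖ₑ :=
        mul_le_mul' le_rfl
          (setLIntegral_mono' (hK.measurableSet.prod measurableSet_Ioo) hpt)
    _ = ENNReal.ofReal C * (ENNReal.ofReal ε⁻¹ *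
        ∫⁻ X in K ×ˢ Ioo (0 : ℝ) ε, ‖coneAverage u X - u X.1‖ₑ) := by
        rw [lintegral_const_mul' _ _ ENNReal.ofReal_ne_top, mul_left_comm]
    _ ≤ _ := mul_le_mul' le_rfl (lintegral_coneAverage_sub_base_le hu hD₀ K hε0)

end Trace

lemma natCast_le_of_mul_le {k : ℕ} {c d : ℝ} (hc : 0 < c) (hd : 0 ≤ d) {G E : ℝ≥0∞}
    (hk : (k : ℝ≥0∞) * ENNReal.ofReal c ≤ G) (hG : G ≤ ENNReal.ofReal d * E) :
    (k : ℝ≥0∞) ≤ ENNReal.ofReal (d / c) * E := by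
  have hc0 : ENNReal.ofReal c ≠ 0 := (ENNReal.ofReal_pos.2 hc).ne'
  rw [← ENNReal.mul_le_mul_iff_left hc0 ENNReal.ofReal_ne_top]
  refine (hk.trans hG).trans_eq ?_
  rw [mul_right_comm, ← ENNReal.ofReal_mul (by positivity), div_mul_cancel₀ _ hc.ne']

lemma pow_pow_le_exp {k n : ℕ} {c M : ℝ} (hc : 0 < c) (hM : 1 ≤ M) {G : ℝ≥0∞} (hG : G ≠ ⊤)
    (hk : (k : ℝ≥0∞) * ENNReal.ofReal c ≤ G) :
    (M ^ k) ^ n ≤ Real.exp ((n * Real.log M / c + 1) * G.toReal) := by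
  have hk' : k * c ≤ G.toReal := by
    have := ENNReal.toReal_mono hG hk
    rwa [ENNReal.toReal_mul, ENNReal.toReal_natCast, ENNReal.toReal_ofReal hc.le] at this
  have hlog := Real.log_nonneg hM
  rw [← pow_mul, ← Real.rpow_natCast, Real.rpow_def_of_pos (by linarith), Real.exp_le_exp]
  push_cast
  calc Real.log M * (k * n) = n * Real.log M / c * (k * c) := by field_simp
    _ ≤ n * Real.log M / c * G.toReal := by gcongr
    _ ≤ _ := by
      have := ENNReal.toReal_nonneg (a := G)
      linarith

lemma gagliardoEnergy_congr {m ν : ℕ} {u v : Euc m → Euc ν} (h : u =ᵐ[volume] v) :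
    gagliardoEnergy m ν u = gagliardoEnergy m ν v := by
  unfold gagliardoEnergy
  refine lintegral_congr_ae ?_
  filter_upwards [h] with x hx
  refine lintegral_congr_ae ?_
  filter_upwards [h] with y hy
  rw [hx, hy]

lemma gapPotential_congr {m ν : ℕ} {δ : ℝ} {u v : Euc m → Euc ν} (h : u =ᵐ[volume] v) :
    gapPotential m ν δ u = gapPotential m ν δ v := by
  unfold gapPotential
  refine lintegral_congr_ae ?_
  filter_upwards [h] with x hx
  refine lintegral_congr_ae ?_
  filter_upwards [h] with y hy
  rw [hx, hy]

lemma setLIntegral_trace_congr {m ν : ℕ} {u v : Euc m → Euc ν} (h : u =ᵐ[volume] v)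
    (U : Euc m × ℝ → Euc ν) (s : Set (Euc m × ℝ)) :
    ∫⁻ X in s, ENNReal.ofReal ‖U X - u X.1‖ = ∫⁻ X in s, ENNReal.ofReal ‖U X - v X.1‖ := by
  refine lintegral_congr_ae (ae_restrict_of_ae ?_)
  have : ∀ᵐ X : Euc m × ℝ, u X.1 = v X.1 := Measure.quasiMeasurePreserving_fst.ae h
  filter_upwards [this] with X hX
  rw [hX]

/-- The multiplicative constant of the extension theorem. -/
def extensionConst (m : ℕ) (D ρ L : ℝ) : ℝ :=
  |weakConst m (L * (2 ^ (m + 1) * avgConst m ^ 2)) * (2 ^ m * unitVol m * 4 ^ (2 * m))| +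
    (1 + (3 * L * lipConst m D) ^ (m + 1) * (volume (ball (0 : Euc m × ℝ) 1)).toReal) *
      ((gapThreshold m D ρ ^ (m + 1))⁻¹ / badMass m D ρ)

/-- The constant in the exponential of the extension theorem. -/
def extensionExponent (m : ℕ) (D ρ : ℝ) : ℝ :=
  (m + 1 : ℕ) * Real.log (coverRatio (gapThreshold m D ρ)) / badMass m D ρ + 1

section Extension

variable {m ν : ℕ} {N : Set (Euc ν)} {D₀ D ρ L : ℝ} {P : Euc ν → Euc ν} {u : Euc m → Euc ν}

lemma extensionConst_pos (hD : 0 < D) (hρ : 0 < ρ) (hL : 0 < L) :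
    0 < extensionConst m D ρ L := by
  have := gapThreshold_pos m hD hρ
  have := badMass_pos m hD hρ
  have := lipConst_nonneg m hD.le
  unfold extensionConst
  positivity

lemma extensionExponent_pos (hD : 0 < D) (hρ : 0 < ρ) : 0 < extensionExponent m D ρ := by
  have := badMass_pos m hD hρ
  have := Real.log_nonneg (one_le_coverRatio (gapThreshold_pos m hD hρ))
  unfold extensionExponent
  positivity

/-- Both estimates of the extension theorem follow from a bound on the number of singularities. -/
lemma count_bound_le_gapBound (hD : 0 < D) (hρ : 0 < ρ) (hL : 0 < L)
    (hE : gagliardoEnergy m ν u ≠ ⊤) {k : ℕ}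
    (hk : (k : ℝ≥0∞) * ENNReal.ofReal (badMass m D ρ) ≤
      gapPotential m ν (gapThreshold m D ρ) u) :
    ENNReal.ofReal (weakConst m (L * (2 ^ (m + 1) * avgConst m ^ 2)) *
        (2 ^ m * unitVol m * 4 ^ (2 * m))) * gagliardoEnergy m ν u +
      k * (1 + ENNReal.ofReal ((3 * L * lipConst m D *
        coverRatio (gapThreshold m D ρ) ^ k) ^ (m + 1)) * volume (ball (0 : Euc m × ℝ) 1)) ≤
      gapBound m ν (extensionConst m D ρ L) (extensionExponent m D ρ) (gapThreshold m D ρ) u := by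
  have hδ := gapThreshold_pos m hD hρ
  have hc := badMass_pos m hD hρ
  have hl := lipConst_nonneg m hD.le
  have hGle := gapPotential_le hδ u
  have hG : gapPotential m ν (gapThreshold m D ρ) u ≠ ⊤ :=
    (hGle.trans_lt (ENNReal.mul_lt_top ENNReal.ofReal_lt_top hE.lt_top)).ne
  have h1 := natCast_le_of_mul_le hc (by positivity) hk hGle
  have h2 := pow_pow_le_exp (n := m + 1) hc (one_le_coverRatio hδ) hG hk
  set e := Real.exp (extensionExponent m D ρ *
    (gapPotential m ν (gapThreshold m D ρ) u).toReal) with he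
  have he1 : 1 ≤ e := Real.one_le_exp
    (mul_nonneg (extensionExponent_pos hD hρ).le ENNReal.toReal_nonneg)
  have hω : volume (ball (0 : Euc m × ℝ) 1) =
      ENNReal.ofReal (volume (ball (0 : Euc m × ℝ) 1)).toReal :=
    (ENNReal.ofReal_toReal measure_ball_lt_top.ne).symm
  unfold gapBound
  rw [← he]
  set w := weakConst m (L * (2 ^ (m + 1) * avgConst m ^ 2)) * (2 ^ m * unitVol m * 4 ^ (2 * m))
    with hw
  set q := (gapThreshold m D ρ ^ (m + 1))⁻¹ / badMass m D ρ with hq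
  have hq0 : 0 ≤ q := by positivity
  set ω := (volume (ball (0 : Euc m × ℝ) 1)).toReal with hωdef
  have hω0 : 0 ≤ ω := ENNReal.toReal_nonneg
  have h3 : 1 + ENNReal.ofReal ((3 * L * lipConst m D *
      coverRatio (gapThreshold m D ρ) ^ k) ^ (m + 1)) * volume (ball (0 : Euc m × ℝ) 1) ≤
      ENNReal.ofReal ((1 + (3 * L * lipConst m D) ^ (m + 1) * ω) * e) := by
    rw [hω, ← ENNReal.ofReal_one, mul_pow, ← ENNReal.ofReal_mul' hω0,
      ← ENNReal.ofReal_add zero_le_one (by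
        have := one_le_coverRatio hδ
        positivity)]
    refine ENNReal.ofReal_le_ofReal ?_
    have : (3 * L * lipConst m D) ^ (m + 1) * (coverRatio (gapThreshold m D ρ) ^ k) ^ (m + 1) * ω
        ≤ (3 * L * lipConst m D) ^ (m + 1) * e * ω := by
      gcongr
      exact h2
    linarith
  calc _ ≤ ENNReal.ofReal (|w| * e) * gagliardoEnergy m ν u +
        ENNReal.ofReal q * gagliardoEnergy m ν u *
          ENNReal.ofReal ((1 + (3 * L * lipConst m D) ^ (m + 1) * ω) * e) := by
        gcongr
        exact (le_abs_self w).trans (le_mul_of_one_le_right (abs_nonneg w) he1)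
    _ = _ := by
        rw [mul_right_comm, ← ENNReal.ofReal_mul hq0, ← add_mul,
          ← ENNReal.ofReal_add (by positivity) (by positivity)]
        congr 2
        simp only [extensionConst, ← hw, ← hq, ← hωdef]
        ring

lemma exists_extension_of_forall_mem (hm : 1 ≤ m) (hρ : 0 < ρ) (hD0 : 0 < D)
    (hD₀ : ∀ a ∈ N, ‖a‖ ≤ D₀) (hD : ∀ a ∈ N, ∀ b ∈ N, ‖a - b‖ ≤ D)
    (hP : ContDiffOn ℝ 1 P {y | infDist y N < ρ})
    (hL0 : 0 < L) (hL : ∀ y ∈ {y | infDist y N < ρ}, ‖fderiv ℝ P y‖ ≤ L)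
    (hmaps : ∀ y ∈ {y | infDist y N < ρ}, P y ∈ N) (hid : ∀ y ∈ N, P y = y)
    (hu : Measurable u) (hN : ∀ x, u x ∈ N) (hE : gagliardoEnergy m ν u ≠ ⊤) :
    ∃ (S : Set (Euc m × ℝ)) (U : Euc m × ℝ → Euc ν),
      S.Finite ∧ S ⊆ {x : Euc m × ℝ | 0 < x.2} ∧
      (S.ncard : ℝ≥0∞) ≤
        gapBound m ν (extensionConst m D ρ L) (extensionExponent m D ρ) (gapThreshold m D ρ) u ∧
      (∀ x : Euc m × ℝ, 0 < x.2 → U x ∈ N) ∧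
      ContinuousOn U ({x : Euc m × ℝ | 0 < x.2} \ S) ∧
      (∀ᵐ x ∂(volume.restrict {x : Euc m × ℝ | 0 < x.2}), DifferentiableAt ℝ U x) ∧
      (∀ t : ℝ, 0 < t →
        ENNReal.ofReal (t ^ (m + 1)) *
          volume {x : Euc m × ℝ | 0 < x.2 ∧ DifferentiableAt ℝ U x ∧ t ≤ ‖fderiv ℝ U x‖}
        ≤ gapBound m ν (extensionConst m D ρ L) (extensionExponent m D ρ)
          (gapThreshold m D ρ) u) ∧
      (∀ K : Set (Euc m), IsCompact K →
        Tendsto (fun ε : ℝ => ENNReal.ofReal ε⁻¹ *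
            ∫⁻ x in K ×ˢ Ioo (0 : ℝ) ε, ENNReal.ofReal ‖U x - u x.1‖)
          (nhdsWithin 0 (Ioi 0)) (nhds 0)) := by
  classical
  have hδ := gapThreshold_pos m hD0 hρ
  have hG : gapPotential m ν (gapThreshold m D ρ) u ≠ ⊤ :=
    ((gapPotential_le hδ u).trans_lt (ENNReal.mul_lt_top ENNReal.ofReal_lt_top hE.lt_top)).ne
  have huD₀ : ∀ z, ‖u z‖ ≤ D₀ := fun z => hD₀ _ (hN z)
  have huD : ∀ y z, ‖u y - u z‖ ≤ D := fun y z => hD _ (hN y) _ (hN z)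
  obtain ⟨k, T, hk, hTk, hin, hd, hH, hcov⟩ := exists_balls_cover hm hu hρ hD0 huD₀ huD hN hG
  have hbound := count_bound_le_gapBound (L := L) hD0 hρ hL0 hE hk
  have hS : ∀ {X : Euc m × ℝ}, X ∉ (↑(T.image Prod.fst) : Set (Euc m × ℝ)) ↔
      ∀ b ∈ T, X ≠ b.1 := by
    intro X
    rw [Finset.mem_coe, Finset.mem_image]
    exact ⟨fun h b hb hXb => h ⟨b, hb, hXb.symm⟩, fun h ⟨b, hb, hXb⟩ => h b hb hXb.symm⟩
  have hLip : ∀ X : Euc m × ℝ, 0 < X.2 → (∀ b ∈ T, X ≠ b.1) →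
      LipschitzNear (singularExtension P (u 0) u T) X := fun X hX hne =>
    lipschitzNear_singularExtension hu huD₀ hD0.le huD hP hL0.le hL hin hd hcov hX hne
  refine ⟨T.image Prod.fst, singularExtension P (u 0) u T, Finset.finite_toSet _, ?_, ?_, ?_, ?_,
    ?_, ?_, ?_⟩
  · intro X hX
    obtain ⟨b, hb, rfl⟩ := Finset.mem_image.1 (Finset.mem_coe.1 hX)
    have := hin b hb
    change 0 < b.1.2
    linarith [this.1, this.2]
  · rw [Set.ncard_coe_finset]
    refine le_trans ?_ (le_add_self.trans hbound)
    refine le_trans ?_ (le_mul_of_one_le_right zero_le le_self_add)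
    exact_mod_cast Finset.card_image_le.trans hTk
  · exact fun X hX => singularExtension_mem hin hd hcov hmaps (hN 0) hX
  · exact fun X hX => (hLip X hX.1 (hS.1 hX.2)).continuousAt.continuousWithinAt
  · have h1 := ae_differentiableAt_of_lipschitzNear (volume : Measure (Euc m × ℝ))
      (f := singularExtension P (u 0) u T)
      (Ω := {x : Euc m × ℝ | 0 < x.2} \ ↑(T.image Prod.fst))
      fun X hX => hLip X hX.1 (hS.1 hX.2)
    have h2 : ∀ᵐ X : Euc m × ℝ, X ∉ (↑(T.image Prod.fst) : Set (Euc m × ℝ)) :=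
      measure_eq_zero_iff_ae_notMem.1 (Finset.measure_zero _ _)
    rw [ae_restrict_iff' (measurableSet_lt measurable_const measurable_snd)]
    filter_upwards [h1, h2] with X hX hXS hX0
    exact hX ⟨hX0, hXS⟩
  · intro t ht
    have hK0 : 0 ≤ coverRatio (gapThreshold m D ρ) ^ k :=
      pow_nonneg (zero_le_one.trans (one_le_coverRatio hδ)) k
    refine (weak_type_singularExtension hm hu huD₀ hD0.le huD hP hL0 hL hin hd hcov hK0 hH
      ht).trans (le_trans ?_ hbound)
    gcongr
    exact le_add_self
  · exact fun K hK => tendsto_trace_singularExtension hm hu huD₀ hN hρ hD0.le hD hP hL hmaps hid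
      hin hcov hE hK

end Extension

/-- Theorem 2: controlled singular extension to the half-space
`ℝ^{m+1}_+ = ℝ^m × (0,∞)` with an exponential weak-type Sobolev estimate. -/
theorem singular_extension_halfspace (m ν : ℕ) (hm : 1 ≤ m) (hν : 1 ≤ ν)
    (N : Set (Euc ν)) (hNne : N.Nonempty) (hNcomp : IsCompact N)
    (ρN : ℝ) (hρN : 0 < ρN) (retr : Euc ν → Euc ν)
    (hretrC1 : ContDiffOn ℝ 1 retr {y | Metric.infDist y N < ρN})
    (hretrbd : ∃ L : ℝ, ∀ y ∈ {y : Euc ν | Metric.infDist y N < ρN},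
      ‖fderiv ℝ retr y‖ ≤ L)
    (hretrmaps : ∀ y ∈ {y : Euc ν | Metric.infDist y N < ρN}, retr y ∈ N)
    (hretrid : ∀ y ∈ N, retr y = y) :
    ∃ A B δ : ℝ, 0 < A ∧ 0 < B ∧ 0 < δ ∧
      ∀ u : Euc m → Euc ν, Measurable u → (∀ᵐ x, u x ∈ N) →
        gagliardoEnergy m ν u ≠ ⊤ →
        ∃ (S : Set (Euc m × ℝ)) (U : Euc m × ℝ → Euc ν),
          S.Finite ∧ S ⊆ {x : Euc m × ℝ | 0 < x.2} ∧
          (S.ncard : ℝ≥0∞) ≤ gapBound m ν A B δ u ∧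
          (∀ x : Euc m × ℝ, 0 < x.2 → U x ∈ N) ∧
          ContinuousOn U ({x : Euc m × ℝ | 0 < x.2} \ S) ∧
          (∀ᵐ x ∂(volume.restrict {x : Euc m × ℝ | 0 < x.2}),
            DifferentiableAt ℝ U x) ∧
          (∀ t : ℝ, 0 < t →
            ENNReal.ofReal (t ^ (m + 1)) *
              volume {x : Euc m × ℝ | 0 < x.2 ∧ DifferentiableAt ℝ U x ∧
                t ≤ ‖fderiv ℝ U x‖}
              ≤ gapBound m ν A B δ u) ∧
          (∀ K : Set (Euc m), IsCompact K →
            Tendsto (fun ε : ℝ => ENNReal.ofReal ε⁻¹ *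
                ∫⁻ x in K ×ˢ Ioo (0 : ℝ) ε, ENNReal.ofReal ‖U x - u x.1‖)
              (nhdsWithin 0 (Ioi 0)) (nhds 0)) := by
  classical
  obtain ⟨D₀, hD₀pos, hD₀⟩ := hNcomp.isBounded.exists_pos_norm_le
  obtain ⟨L₀, hL₀⟩ := hretrbd
  obtain ⟨n₀, hn₀⟩ := hNne
  have hD : ∀ a ∈ N, ∀ b ∈ N, ‖a - b‖ ≤ 2 * D₀ := fun a ha b hb => by
    linarith [norm_sub_le a b, hD₀ a ha, hD₀ b hb]
  have hDpos : 0 < 2 * D₀ := by positivity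
  have hLpos : 0 < max L₀ 1 := lt_max_of_lt_right one_pos
  have hL : ∀ y ∈ {y : Euc ν | infDist y N < ρN}, ‖fderiv ℝ retr y‖ ≤ max L₀ 1 :=
    fun y hy => (hL₀ y hy).trans (le_max_left _ _)
  refine ⟨extensionConst m (2 * D₀) ρN (max L₀ 1), extensionExponent m (2 * D₀) ρN,
    gapThreshold m (2 * D₀) ρN, extensionConst_pos hDpos hρN hLpos,
    extensionExponent_pos hDpos hρN, gapThreshold_pos m hDpos hρN, fun u hu huN hE => ?_⟩
  let v : Euc m → Euc ν := (u ⁻¹' N).piecewise u fun _ => n₀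
  have hv : Measurable v :=
    hu.piecewise (hu hNcomp.isClosed.measurableSet) measurable_const
  have hvN : ∀ x, v x ∈ N := fun x => by
    by_cases hx : x ∈ u ⁻¹' N
    · rwa [show v x = u x from piecewise_eq_of_mem _ _ _ hx]
    · rwa [show v x = n₀ from piecewise_eq_of_notMem _ _ _ hx]
  have huv : u =ᵐ[volume] v := by
    filter_upwards [huN] with x hx
    exact (piecewise_eq_of_mem (u ⁻¹' N) _ _ hx).symm
  rw [gagliardoEnergy_congr huv] at hE
  have h := exists_extension_of_forall_mem hm hρN hDpos hD₀ hD hretrC1 hLpos hL hretrmaps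
    hretrid hv hvN hE
  simpa only [gapBound, gagliardoEnergy_congr huv, gapPotential_congr huv,
    setLIntegral_trace_congr huv] using h
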